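/- arXiv:2503.23648 — 3 statements merged into one kernel-verified Lean document; each statement's English description precedes it below -/
import Mathlib

section
/- There exists a constant c > 0 such that for every sufficiently large integer N the following holds. Let G = SL₂(ℤ/Nℤ) and let S = {A·D, A²·D} (reduced modulo N), and let T = S ∪ S⁻¹. Then for every subset U of G with |U| ≤ |G|/2, the external neighborhood {g ∈ G : g ∉ U and g = u·s for some u ∈ U and s ∈ T} has size at least c·|U|. -/
open Matrix

/-- The matrix `A = [[1,1],[0,1]]` as an element of `SL₂(ℤ/Nℤ)`. -/
def slA (N : ℕ) : Matrix.SpecialLinearGroup (Fin 2) (ZMod N) :=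
  ⟨!![1, 1; 0, 1], by simp [Matrix.det_fin_two_of]⟩

/-- The matrix `D = [[1,0],[1,1]]` as an element of `SL₂(ℤ/Nℤ)`. -/
def slD (N : ℕ) : Matrix.SpecialLinearGroup (Fin 2) (ZMod N) :=
  ⟨!![1, 0; 1, 1], by simp [Matrix.det_fin_two_of]⟩

/-- The generating set `S = {A·D, A²·D}` in `SL₂(ℤ/Nℤ)`. -/
def genS (N : ℕ) : Set (Matrix.SpecialLinearGroup (Fin 2) (ZMod N)) :=
  {slA N * slD N, slA N ^ 2 * slD N}

/-! ### Arithmetic preliminaries -/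

theorem Nat.exists_card_divisors_le_rpow {ε : ℝ} (hε : 0 < ε) :
    ∃ C : ℝ, 1 ≤ C ∧ ∀ n : ℕ, n ≠ 0 → (n.divisors.card : ℝ) ≤ C * (n : ℝ) ^ ε := by
  set C₀ : ℝ := max 1 (1 / (ε * Real.log 2)) with hC₀
  have hlog : 0 < Real.log 2 := Real.log_pos one_lt_two
  have hC₀1 : 1 ≤ C₀ := le_max_left _ _
  set P := ⌈(2 : ℝ) ^ (1 / ε)⌉₊ with hP
  refine ⟨C₀ ^ P, one_le_pow₀ hC₀1, fun n hn => ?_⟩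
  have small : ∀ p v : ℕ, 2 ≤ p → ((v + 1 : ℕ) : ℝ) ≤ C₀ * ((p : ℝ) ^ v) ^ ε := by
    intro p v hp
    have h2 : (2 : ℝ) ^ (ε * v) ≤ ((p : ℝ) ^ v) ^ ε := by
      rw [← Real.rpow_natCast, ← Real.rpow_mul (by positivity), mul_comm ε]
      exact Real.rpow_le_rpow (by norm_num) (by exact_mod_cast hp) (by positivity)
    have h3 : 1 + Real.log 2 * (ε * v) ≤ (2 : ℝ) ^ (ε * v) := by
      rw [Real.rpow_def_of_pos two_pos]
      linarith [Real.add_one_le_exp (Real.log 2 * (ε * v))]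
    have h4 : 1 ≤ C₀ * (ε * Real.log 2) := by
      have := mul_le_mul_of_nonneg_right (le_max_right 1 (1 / (ε * Real.log 2)))
        (mul_pos hε hlog).le
      rwa [one_div_mul_cancel (mul_pos hε hlog).ne'] at this
    calc ((v + 1 : ℕ) : ℝ) = 1 + 1 * v := by push_cast; ring
      _ ≤ C₀ + (C₀ * (ε * Real.log 2)) * v := by gcongr
      _ = C₀ * (1 + Real.log 2 * (ε * v)) := by ring
      _ ≤ C₀ * ((p : ℝ) ^ v) ^ ε := by gcongr; exact h3.trans h2
  have large : ∀ p v : ℕ, P ≤ p → ((v + 1 : ℕ) : ℝ) ≤ ((p : ℝ) ^ v) ^ ε := by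
    intro p v hp
    have h1 : (2 : ℝ) ≤ (p : ℝ) ^ ε := by
      have : (2 : ℝ) ^ (1 / ε) ≤ p := (Nat.le_ceil _).trans (by exact_mod_cast hp)
      calc (2 : ℝ) = ((2 : ℝ) ^ (1 / ε)) ^ ε := by
            rw [← Real.rpow_mul (by norm_num), one_div_mul_cancel hε.ne', Real.rpow_one]
        _ ≤ _ := Real.rpow_le_rpow (by positivity) this hε.le
    have h2 : ((v + 1 : ℕ) : ℝ) ≤ 2 ^ v := by
      exact_mod_cast Nat.lt_two_pow_self
    calc ((v + 1 : ℕ) : ℝ) ≤ 2 ^ v := h2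
      _ ≤ ((p : ℝ) ^ ε) ^ v := by gcongr
      _ = _ := by rw [← Real.rpow_natCast, ← Real.rpow_natCast, ← Real.rpow_mul (by positivity),
        ← Real.rpow_mul (by positivity), mul_comm]
  have key : ∀ p ∈ n.primeFactors, ((n.factorization p + 1 : ℕ) : ℝ) ≤
      (if p < P then C₀ else 1) * ((p : ℝ) ^ n.factorization p) ^ ε := by
    intro p hp
    split_ifs with h
    · exact small p _ (Nat.prime_of_mem_primeFactors hp).two_le
    · rw [one_mul]; exact large p _ (not_lt.1 h)
  have hprod : ∏ p ∈ n.primeFactors, ((p : ℝ) ^ n.factorization p) ^ ε = (n : ℝ) ^ ε := by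
    rw [Real.finsetProd_rpow _ _ (fun _ _ => by positivity)]
    congr 1
    conv_rhs => rw [← Nat.prod_factorization_pow_eq_self hn]
    rw [Finsupp.prod, Nat.support_factorization]
    push_cast; rfl
  rw [Nat.card_divisors hn]
  push_cast [Finset.prod_natCast] at key ⊢
  calc _ ≤ ∏ p ∈ n.primeFactors, ((if p < P then C₀ else 1) *
        ((p : ℝ) ^ n.factorization p) ^ ε) :=
        Finset.prod_le_prod (fun _ _ => by positivity) key
    _ = (∏ p ∈ n.primeFactors, if p < P then C₀ else 1) * (n : ℝ) ^ ε := by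
        rw [Finset.prod_mul_distrib, hprod]
    _ ≤ C₀ ^ P * (n : ℝ) ^ ε := by
        gcongr
        rw [← Finset.prod_filter, Finset.prod_const]
        refine pow_le_pow_right₀ hC₀1 ?_
        calc _ ≤ (Finset.range P).card := Finset.card_le_card fun p hp => by
              simp only [Finset.mem_filter] at hp; simpa using hp.2
          _ = P := Finset.card_range P

theorem Nat.le_totient_mul_card_divisors (n : ℕ) : n ≤ n.totient * n.divisors.card := by
  induction n using Nat.recOnPosPrimePosCoprime with
  | zero => simp
  | one => simp
  | prime_pow p k hp hk =>
    rw [Nat.totient_prime_pow hp hk, Nat.divisors_prime_pow hp, Finset.card_map,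
      Finset.card_range]
    obtain ⟨m, rfl⟩ : ∃ m, k = m + 1 := ⟨k - 1, by omega⟩
    obtain ⟨q, rfl⟩ : ∃ q, p = q + 2 := ⟨p - 2, by have := hp.two_le; omega⟩
    have : q + 2 ≤ (q + 1) * (m + 1 + 1) := by nlinarith
    calc (q + 2) ^ (m + 1) = (q + 2) ^ m * (q + 2) := pow_succ _ _
      _ ≤ (q + 2) ^ m * ((q + 1) * (m + 1 + 1)) := Nat.mul_le_mul_left _ this
      _ = _ := by simp; ring
  | coprime a b ha hb hab iha ihb =>
    rw [Nat.totient_mul hab, hab.card_divisors_mul]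
    calc a * b ≤ (a.totient * a.divisors.card) * (b.totient * b.divisors.card) :=
          Nat.mul_le_mul iha ihb
      _ = _ := by ring

/-- A level has few square roots of one. -/
theorem ZMod.card_sq_eq_one_le (N : ℕ) [NeZero N] :
    (Finset.univ.filter fun t : (ZMod N)ˣ => t ^ 2 = 1).card ≤ 2 * N.divisors.card := by
  classical
  set d : (ZMod N)ˣ → ℕ := fun t => Int.gcd ((t : ZMod N).val - 1 : ℤ) N with hd
  rw [mul_comm]
  refine (Finset.card_le_mul_card_image_of_maps_to (f := d) (t := N.divisors) ?_ 2 ?_).trans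
    (by rw [mul_comm])
  · intro t _
    rw [Nat.mem_divisors]
    exact ⟨Int.natCast_dvd_natCast.1 (Int.gcd_dvd_right _ _), NeZero.ne N⟩
  · intro e he
    have he0 : (e : ℤ) ≠ 0 := by
      exact_mod_cast (Nat.pos_of_mem_divisors he).ne'
    obtain ⟨m, hm⟩ := Nat.dvd_of_mem_divisors he
    have hmZ : (N : ℤ) = e * m := by exact_mod_cast hm
    have fact : ∀ t : (ZMod N)ˣ, t ^ 2 = 1 → d t = e →
        (e : ℤ) ∣ (t : ZMod N).val - 1 ∧ (m : ℤ) ∣ (t : ZMod N).val + 1 := by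
      intro t ht hte
      have h1 : (N : ℤ) ∣ ((t : ZMod N).val - 1) * ((t : ZMod N).val + 1) := by
        rw [← ZMod.intCast_zmod_eq_zero_iff_dvd]
        have := congrArg (fun u : (ZMod N)ˣ => (u : ZMod N)) ht
        push_cast at this ⊢
        rw [ZMod.natCast_zmod_val]
        linear_combination this
      refine ⟨hte ▸ Int.gcd_dvd_left _ _, ?_⟩
      have hb := Int.gcd_eq_gcd_ab ((t : ZMod N).val - 1 : ℤ) N
      rw [show Int.gcd ((t : ZMod N).val - 1 : ℤ) N = e from hte] at hb
      have h2 : (e : ℤ) * m ∣ e * ((t : ZMod N).val + 1) := by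
        rw [← hmZ]
        conv_rhs => rw [hb]
        rw [add_mul]
        refine dvd_add ?_ ?_
        · rw [mul_right_comm]; exact h1.mul_right _
        · rw [mul_assoc]; exact dvd_mul_right _ _
      exact (mul_dvd_mul_iff_left he0).1 h2
    rcases Finset.eq_empty_or_nonempty
      ((Finset.univ.filter fun t : (ZMod N)ˣ => t ^ 2 = 1).filter fun t => d t = e) with h | ⟨t₀, h₀⟩
    · rw [h]; simp
    simp only [Finset.mem_filter, Finset.mem_univ, true_and] at h₀
    obtain ⟨a1, a2⟩ := fact t₀ h₀.1 h₀.2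
    calc _ ≤ (Finset.univ.filter fun x : ZMod N => 2 • x = 0).card := by
          refine Finset.card_le_card_of_injOn (fun t => (t : ZMod N) - t₀) ?_ ?_
          · intro t ht
            simp only [Finset.coe_filter, Finset.mem_filter, Finset.mem_univ, true_and,
              Set.mem_ofPred_eq] at ht
            obtain ⟨b1, b2⟩ := fact t ht.1 ht.2
            have hx1 : (e : ℤ) ∣ ((t : ZMod N).val : ℤ) - (t₀ : ZMod N).val := by
              have := dvd_sub b1 a1; ring_nf at this ⊢; exact this
            have hx2 : (m : ℤ) ∣ ((t : ZMod N).val : ℤ) - (t₀ : ZMod N).val := by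
              have := dvd_sub b2 a2; ring_nf at this ⊢; exact this
            have : (N : ℤ) ∣ 2 * (((t : ZMod N).val : ℤ) - (t₀ : ZMod N).val) := by
              rw [hmZ]
              have h1 := mul_dvd_mul b1 hx2
              have h2 := mul_dvd_mul hx1 b2
              have := dvd_sub h2 h1
              ring_nf at this ⊢
              exact this
            rw [← ZMod.intCast_zmod_eq_zero_iff_dvd] at this
            push_cast at this
            rw [ZMod.natCast_zmod_val, ZMod.natCast_zmod_val] at this
            simpa [two_nsmul, two_mul] using this
          · intro t _ t' _ htt
            exact Units.ext (sub_left_injective htt)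
      _ ≤ 2 := by
          simpa using IsAddCyclic.card_nsmul_eq_zero_le (α := ZMod N) (n := 2) (by norm_num)

theorem ZMod.totient_le_card_squares (N : ℕ) [NeZero N] :
    N.totient ≤ 2 * N.divisors.card *
      (Finset.univ.image fun t : (ZMod N)ˣ => t ^ 2).card := by
  classical
  rw [← ZMod.card_units_eq_totient, ← Finset.card_univ]
  refine Finset.card_le_mul_card_image _ _ ?_
  intro b hb
  obtain ⟨t₀, -, rfl⟩ := Finset.mem_image.1 hb
  refine le_trans ?_ (ZMod.card_sq_eq_one_le N)
  refine Finset.card_le_card_of_injOn (fun t => t * t₀⁻¹) ?_ ?_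
  · intro t ht
    simp only [Finset.coe_filter, Finset.mem_univ, true_and, Set.mem_ofPred_eq] at ht ⊢
    rw [mul_pow, ht, inv_pow, mul_inv_cancel]
  · intro t _ t' _ h
    exact mul_right_cancel h

theorem ZMod.exists_card_squares_ge {ε : ℝ} (hε : 0 < ε) :
    ∃ C : ℝ, 1 ≤ C ∧ ∀ N : ℕ, ∀ _ : NeZero N,
      (N : ℝ) ≤ C * (N : ℝ) ^ ε * (Finset.univ.image fun t : (ZMod N)ˣ => t ^ 2).card := by
  obtain ⟨C, hC, h⟩ := Nat.exists_card_divisors_le_rpow (half_pos hε)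
  refine ⟨2 * C ^ 2, by nlinarith, fun N _ => ?_⟩
  have h1 := Nat.le_totient_mul_card_divisors N
  have h2 := ZMod.totient_le_card_squares N
  set q := (Finset.univ.image fun t : (ZMod N)ˣ => t ^ 2).card
  have h3 : N ≤ 2 * N.divisors.card * q * N.divisors.card :=
    h1.trans (Nat.mul_le_mul_right _ h2)
  have h3' : (N : ℝ) ≤ 2 * N.divisors.card * q * N.divisors.card := by exact_mod_cast h3
  have h4 := h N (NeZero.ne N)
  have hN : (0 : ℝ) < N := by exact_mod_cast NeZero.pos N
  calc (N : ℝ) ≤ 2 * q * (N.divisors.card) ^ 2 := by linarith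
    _ ≤ 2 * q * (C * (N : ℝ) ^ (ε / 2)) ^ 2 := by gcongr
    _ = 2 * C ^ 2 * ((N : ℝ) ^ (ε / 2)) ^ 2 * q := by ring
    _ = 2 * C ^ 2 * (N : ℝ) ^ ε * q := by
      rw [← Real.rpow_natCast ((N : ℝ) ^ (ε / 2)) 2, ← Real.rpow_mul hN.le]
      norm_num

theorem Finset.sum_union_le_add {α : Type*} [DecidableEq α] {s t : Finset α} {f : α → ℝ}
    (hf : ∀ a, 0 ≤ f a) : ∑ a ∈ s ∪ t, f a ≤ ∑ a ∈ s, f a + ∑ a ∈ t, f a := by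
  rw [← Finset.sum_union_inter]
  exact le_add_of_nonneg_right (Finset.sum_nonneg fun a _ => hf a)

theorem sum_one_div_abs_add_one_le (J : ℕ) :
    ∑ j ∈ Finset.Icc (-(J : ℤ)) J, (1 : ℝ) / (|(j : ℝ)| + 1) ≤ 2 * (1 + Real.log (J + 1)) := by
  have hcover : Finset.Icc (-(J : ℤ)) J ⊆
      (Finset.range (J + 1)).image (fun n : ℕ => (n : ℤ)) ∪
        (Finset.range (J + 1)).image (fun n : ℕ => -(n : ℤ)) := by
    intro j hj
    rw [Finset.mem_Icc] at hj
    simp only [Finset.mem_union, Finset.mem_image, Finset.mem_range]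
    rcases le_total 0 j with h | h
    · exact Or.inl ⟨j.toNat, by omega, by omega⟩
    · exact Or.inr ⟨(-j).toNat, by omega, by omega⟩
  have hh : ∑ n ∈ Finset.range (J + 1), (1 : ℝ) / ((n : ℝ) + 1) ≤ 1 + Real.log (J + 1) := by
    have := harmonic_le_one_add_log (J + 1)
    rw [harmonic] at this
    push_cast at this
    simpa using this
  have hpos : ∀ j : ℤ, (0 : ℝ) ≤ 1 / (|(j : ℝ)| + 1) := fun j => by positivity
  calc _ ≤ _ := Finset.sum_le_sum_of_subset_of_nonneg hcover fun j _ _ => hpos j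
    _ ≤ _ := Finset.sum_union_le_add hpos
    _ ≤ _ := by
      rw [Finset.sum_image (by intro a _ b _ h; simpa using h),
        Finset.sum_image (by intro a _ b _ h; simpa using h)]
      simp only [Int.cast_neg, Int.cast_natCast, abs_neg, Nat.abs_cast]
      linarith

/-! ### A block of unimodular matrices of comparable size -/

/-- The sup norm of an integer vector. -/
noncomputable def vnorm (x y : ℤ) : ℝ := max |(x : ℝ)| |(y : ℝ)|

theorem vnorm_nonneg (x y : ℤ) : 0 ≤ vnorm x y := le_max_of_le_left (abs_nonneg _)

theorem sl2_det (h : SpecialLinearGroup (Fin 2) ℤ) : h 0 0 * h 1 1 - h 0 1 * h 1 0 = 1 := by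
  have := h.det_coe
  rwa [Matrix.det_fin_two] at this

theorem sl2_ext {R : Type*} [CommRing R] {g h : SpecialLinearGroup (Fin 2) R}
    (h1 : g 0 0 = h 0 0) (h2 : g 0 1 = h 0 1) (h3 : g 1 0 = h 1 0) (h4 : g 1 1 = h 1 1) :
    g = h := by
  ext i j
  fin_cases i <;> fin_cases j <;> assumption

theorem finite_sl2_entries_le (X : ℕ) :
    {g : SpecialLinearGroup (Fin 2) ℤ | ∀ i j, |g i j| ≤ X}.Finite := by
  have hf : (Set.pi Set.univ fun _ : Fin 2 =>
      Set.pi Set.univ fun _ : Fin 2 => Set.Icc (-(X : ℤ)) X).Finite :=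
    Set.Finite.pi fun _ => Set.Finite.pi fun _ => Set.finite_Icc _ _
  refine Set.Finite.of_finite_image (f := fun g i j => g i j) (hf.subset ?_) ?_
  · rintro _ ⟨g, hg, rfl⟩
    simp only [Set.mem_pi, Set.mem_univ, true_imp_iff, Set.mem_Icc]
    exact fun i j => abs_le.1 (hg i j)
  · intro g _ h _ hgh
    ext i j
    exact congrFun (congrFun hgh i) j

/-- Elements of `SL₂(ℤ)` with entries bounded by `X`. -/
noncomputable def slBall (X : ℕ) : Finset (SpecialLinearGroup (Fin 2) ℤ) :=
  (finite_sl2_entries_le X).toFinset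

theorem mem_slBall {X : ℕ} {g : SpecialLinearGroup (Fin 2) ℤ} :
    g ∈ slBall X ↔ ∀ i j, |g i j| ≤ X := by
  simp [slBall]

/-- Elements of `SL₂(ℤ)` of size about `R` whose upper left entry dominates. -/
noncomputable def cell (R : ℕ) : Finset (SpecialLinearGroup (Fin 2) ℤ) :=
  (slBall R).filter fun h => (R : ℤ) < 2 * h 0 0 ∧ h 0 0 ≤ R ∧
    (0 ≤ h 0 1 ∧ h 0 1 < h 0 0) ∧ (0 ≤ h 1 0 ∧ h 1 0 < h 0 0)

theorem mem_cell {R : ℕ} {h : SpecialLinearGroup (Fin 2) ℤ} :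
    h ∈ cell R ↔ (R : ℤ) < 2 * h 0 0 ∧ h 0 0 ≤ R ∧
      (0 ≤ h 0 1 ∧ h 0 1 < h 0 0) ∧ (0 ≤ h 1 0 ∧ h 1 0 < h 0 0) := by
  refine ⟨fun hh => (Finset.mem_filter.1 hh).2, fun hh => Finset.mem_filter.2 ⟨?_, hh⟩⟩
  rw [mem_slBall]
  obtain ⟨h1, h2, ⟨h3, h4⟩, h5, h6⟩ := hh
  have hd := sl2_det h
  have hd0 : 0 ≤ h 1 1 := by nlinarith [mul_nonneg h3 h5]
  have hd1 : h 1 1 ≤ h 0 0 := by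
    by_contra! hc
    nlinarith [mul_le_mul (Int.le_sub_one_of_lt h4) (Int.le_sub_one_of_lt h6) h5 (by linarith)]
  intro i j
  rw [abs_le]
  fin_cases i <;> fin_cases j <;> simp <;> constructor <;> linarith

theorem cell_eq_of_row {R : ℕ} {g h : SpecialLinearGroup (Fin 2) ℤ} (hg : g ∈ cell R)
    (hh : h ∈ cell R) (h0 : g 0 0 = h 0 0) (h1 : g 0 1 = h 0 1) : g = h := by
  rw [mem_cell] at hg hh
  have e1 := sl2_det g
  have e2 := sl2_det h
  have ha : 0 < h 0 0 := by linarith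
  have hc : g 1 0 = h 1 0 := by
    have hdvd : h 0 0 ∣ g 1 0 - h 1 0 := by
      refine ⟨h 1 1 * (g 1 0 - h 1 0) - h 1 0 * (g 1 1 - h 1 1), ?_⟩
      rw [h0, h1] at e1
      linear_combination (-(g 1 0 - h 1 0)) * e2 + (e1 - e2) * h 1 0
    have := Int.eq_zero_of_abs_lt_dvd hdvd (by
      rw [abs_lt]; constructor <;> linarith)
    linarith
  refine sl2_ext h0 h1 hc ?_
  rw [h0, h1, hc] at e1
  exact mul_left_cancel₀ ha.ne' (by linarith)

theorem card_cell_le (R : ℕ) : (cell R).card ≤ R ^ 2 := by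
  calc (cell R).card ≤ (Finset.Icc (1 : ℤ) R ×ˢ Finset.Ico (0 : ℤ) R).card := by
        refine Finset.card_le_card_of_injOn (fun h => (h 0 0, h 0 1)) ?_ ?_
        · intro h hh
          obtain ⟨h1, h2, h3, h4⟩ := mem_cell.1 hh
          simp only [Finset.coe_product, Set.mem_prod, Finset.coe_Icc, Finset.coe_Ico,
            Set.mem_Icc, Set.mem_Ico]
          omega
        · intro g hg h hh hgh
          simp only [Prod.mk.injEq] at hgh
          exact cell_eq_of_row hg hh hgh.1 hgh.2
    _ = R ^ 2 := by simp [sq]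

theorem cell_row_injective {R : ℕ} {g h : SpecialLinearGroup (Fin 2) ℤ} (hg : g ∈ cell R)
    (hh : h ∈ cell R) (hgh : g 0 1 * h 0 0 = h 0 1 * g 0 0) : g = h := by
  have hg' := mem_cell.1 hg
  have hh' := mem_cell.1 hh
  have e1 := sl2_det g
  have e2 := sl2_det h
  have h0 : g 0 0 = h 0 0 := by
    refine Int.dvd_antisymm (by linarith) (by linarith)
      ⟨h 0 0 * g 1 1 - h 0 1 * g 1 0, ?_⟩ ⟨g 0 0 * h 1 1 - g 0 1 * h 1 0, ?_⟩
    · linear_combination (-h 0 0) * e1 - g 1 0 * hgh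
    · linear_combination (-g 0 0) * e2 + h 1 0 * hgh
  refine cell_eq_of_row hg hh h0 ?_
  rw [h0] at hgh
  exact mul_right_cancel₀ (by linarith : h 0 0 ≠ 0) hgh

/-- The eigenvalue bound for the supersolution `1 / ‖·‖` on `cell R`. -/
noncomputable def cellBound (R : ℕ) : ℝ := 24 * R * (1 + Real.log (3 * (R : ℝ) ^ 2 + 2))

theorem sum_cell_le_of_small {R : ℕ} {p q : ℤ} (hpq : 2 * |(q : ℝ)| < |(p : ℝ)|) :
    ∑ h ∈ cell R, 1 / vnorm (h 0 0 * p + h 0 1 * q) (h 1 0 * p + h 1 1 * q) ≤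
      cellBound R / vnorm p q := by
  have hp : 0 < |(p : ℝ)| := by linarith [abs_nonneg (q : ℝ)]
  have hv : vnorm p q = |(p : ℝ)| := max_eq_left (by linarith [abs_nonneg (q : ℝ)])
  rcases Nat.eq_zero_or_pos R with rfl | hR
  · have : cell 0 = ∅ := by
      rw [Finset.eq_empty_iff_forall_notMem]
      intro h hh
      have := mem_cell.1 hh
      omega
    rw [this]
    simp [cellBound]
  have hR' : (0 : ℝ) < R := by exact_mod_cast hR
  have hterm : ∀ h ∈ cell R,
      1 / vnorm (h 0 0 * p + h 0 1 * q) (h 1 0 * p + h 1 1 * q) ≤ 4 / (R * |(p : ℝ)|) := by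
    intro h hh
    obtain ⟨h1, h2, ⟨h3, h4⟩, h5, h6⟩ := mem_cell.1 hh
    have h1' : (R : ℝ) < 2 * (h 0 0 : ℝ) := by exact_mod_cast h1
    have h3' : (0 : ℝ) ≤ (h 0 1 : ℝ) := by exact_mod_cast h3
    have h4' : (h 0 1 : ℝ) < (h 0 0 : ℝ) := by exact_mod_cast h4
    have hL : R * |(p : ℝ)| / 4 ≤ |((h 0 0 * p + h 0 1 * q : ℤ) : ℝ)| := by
      push_cast
      have e1 : |(h 0 0 : ℝ) * p| - |(h 0 1 : ℝ) * q| ≤ |(h 0 0 : ℝ) * p + h 0 1 * q| := by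
        have := abs_sub_abs_le_abs_sub ((h 0 0 : ℝ) * p) (-((h 0 1 : ℝ) * q))
        rwa [abs_neg, sub_neg_eq_add] at this
      rw [abs_mul, abs_mul, abs_of_pos (by linarith : (0 : ℝ) < h 0 0), abs_of_nonneg h3'] at e1
      have e2 : (h 0 1 : ℝ) * |(q : ℝ)| ≤ (h 0 0 : ℝ) * |(q : ℝ)| := by gcongr
      nlinarith
    have hpos : 0 < R * |(p : ℝ)| / 4 := by positivity
    calc _ ≤ 1 / (R * |(p : ℝ)| / 4) :=
          one_div_le_one_div_of_le hpos (hL.trans (le_max_left _ _))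
      _ = _ := by rw [one_div_div]
  calc _ ≤ ∑ _h ∈ cell R, 4 / (R * |(p : ℝ)|) := Finset.sum_le_sum hterm
    _ = (cell R).card * (4 / (R * |(p : ℝ)|)) := by rw [Finset.sum_const, nsmul_eq_mul]
    _ ≤ (R : ℝ) ^ 2 * (4 / (R * |(p : ℝ)|)) := by
        gcongr
        exact_mod_cast card_cell_le R
    _ = 4 * R / |(p : ℝ)| := by field_simp
    _ ≤ cellBound R / vnorm p q := by
        rw [hv, cellBound]
        refine div_le_div_of_nonneg_right ?_ hp.le
        have : 0 ≤ Real.log (3 * (R : ℝ) ^ 2 + 2) := Real.log_nonneg (by nlinarith)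
        nlinarith

theorem sum_cell_le_of_large {R : ℕ} {p q : ℤ} (hq : q ≠ 0) (hpq : |(p : ℝ)| ≤ 2 * |(q : ℝ)|) :
    ∑ h ∈ cell R, 1 / vnorm (h 0 0 * p + h 0 1 * q) (h 1 0 * p + h 1 1 * q) ≤
      cellBound R / vnorm p q := by
  have hq' : 0 < |(q : ℝ)| := abs_pos.2 (by exact_mod_cast hq)
  have hq0 : (q : ℝ) ≠ 0 := by exact_mod_cast hq
  have hvpos : 0 < vnorm p q := lt_max_of_lt_right hq'
  have hv : vnorm p q ≤ 2 * |(q : ℝ)| := max_le hpq (by linarith)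
  set η : SpecialLinearGroup (Fin 2) ℤ → ℝ := fun h => (p : ℝ) / q + (h 0 1 : ℝ) / h 0 0 with hη
  set j : SpecialLinearGroup (Fin 2) ℤ → ℤ := fun h => ⌊(R : ℝ) ^ 2 * η h⌋ with hj
  have facts : ∀ h ∈ cell R, (0 : ℝ) < R ∧ (R : ℝ) < 2 * (h 0 0 : ℝ) ∧ (h 0 0 : ℝ) ≤ R ∧
      (0 : ℝ) ≤ (h 0 1 : ℝ) ∧ (h 0 1 : ℝ) < (h 0 0 : ℝ) ∧ (0 : ℝ) ≤ (h 1 0 : ℝ) ∧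
      (h 1 0 : ℝ) < (h 0 0 : ℝ) := by
    intro h hh
    obtain ⟨h1, h2, ⟨h3, h4⟩, h5, h6⟩ := mem_cell.1 hh
    exact ⟨by exact_mod_cast (by omega : 0 < R), by exact_mod_cast h1, by exact_mod_cast h2,
      by exact_mod_cast h3, by exact_mod_cast h4, by exact_mod_cast h5, by exact_mod_cast h6⟩
  have hinj : Set.InjOn j (cell R) := by
    intro g hg h hh hgh
    obtain ⟨hR, g1, g2, g3, g4, -⟩ := facts g hg
    obtain ⟨-, h1, h2, h3, h4, -⟩ := facts h hh
    refine cell_row_injective hg hh ?_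
    by_contra hne
    have hint : (1 : ℝ) ≤ |(g 0 1 : ℝ) * h 0 0 - h 0 1 * g 0 0| := by
      exact_mod_cast Int.one_le_abs (sub_ne_zero.2 hne)
    have hdiff := Int.abs_sub_lt_one_of_floor_eq_floor hgh
    have ga : (0 : ℝ) < g 0 0 := by linarith
    have ha : (0 : ℝ) < h 0 0 := by linarith
    have heq : (R : ℝ) ^ 2 * η g - R ^ 2 * η h =
        R ^ 2 / (g 0 0 * h 0 0) * ((g 0 1 : ℝ) * h 0 0 - h 0 1 * g 0 0) := by
      simp only [hη]; field_simp; ring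
    rw [heq, abs_mul, abs_of_pos (by positivity)] at hdiff
    have : 1 ≤ (R : ℝ) ^ 2 / (g 0 0 * h 0 0) := by
      rw [one_le_div (by positivity), sq]
      gcongr
    nlinarith
  have hterm : ∀ h ∈ cell R,
      1 / vnorm (h 0 0 * p + h 0 1 * q) (h 1 0 * p + h 1 1 * q) ≤
        12 * R / vnorm p q * (1 / (|(j h : ℝ)| + 1)) := by
    intro h hh
    obtain ⟨hR, h1, h2, h3, h4, h5, h6⟩ := facts h hh
    have ha : (0 : ℝ) < h 0 0 := by linarith
    set x : ℝ := ((h 0 0 * p + h 0 1 * q : ℤ) : ℝ) with hx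
    set y : ℝ := ((h 1 0 * p + h 1 1 * q : ℤ) : ℝ) with hy
    have hw : vnorm (h 0 0 * p + h 0 1 * q) (h 1 0 * p + h 1 1 * q) = max |x| |y| := rfl
    have hxη : x = h 0 0 * q * η h := by
      simp only [hx, hη]; push_cast; field_simp
    have b1 : |(q : ℝ)| / (2 * R) * ((R : ℝ) ^ 2 * |η h|) ≤ max |x| |y| := by
      refine le_trans ?_ (le_max_left _ _)
      rw [hxη, abs_mul, abs_mul, abs_of_pos ha]
      calc _ = (R / 2) * |(q : ℝ)| * |η h| := by field_simp
        _ ≤ _ := by gcongr; linarith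
    have b2 : |(q : ℝ)| / (2 * R) ≤ max |x| |y| := by
      have hdet : (q : ℝ) = h 0 0 * y - h 1 0 * x := by
        have := sl2_det h
        have : (h 0 0 : ℝ) * h 1 1 - h 0 1 * h 1 0 = 1 := by exact_mod_cast this
        simp only [hx, hy]; push_cast
        linear_combination (-(q : ℝ)) * this
      have : |(q : ℝ)| ≤ h 0 0 * |y| + h 1 0 * |x| := by
        rw [hdet]
        refine (abs_sub _ _).trans ?_
        rw [abs_mul, abs_mul, abs_of_pos ha, abs_of_nonneg h5]
      have c1 : (h 0 0 : ℝ) * |y| ≤ R * max |x| |y| := by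
        gcongr; exact le_max_right _ _
      have c2 : (h 1 0 : ℝ) * |x| ≤ R * max |x| |y| := by
        gcongr
        · linarith
        · exact le_max_left _ _
      rw [div_le_iff₀ (by positivity)]
      linarith
    have b3 : (|(j h : ℝ)| + 1) / 3 ≤ max ((R : ℝ) ^ 2 * |η h|) 1 := by
      have f1 := Int.floor_le ((R : ℝ) ^ 2 * η h)
      have f2 := Int.lt_floor_add_one ((R : ℝ) ^ 2 * η h)
      have f3 : |(j h : ℝ)| ≤ (R : ℝ) ^ 2 * |η h| + 1 := by
        have e : (R : ℝ) ^ 2 * |η h| = |(R : ℝ) ^ 2 * η h| := by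
          rw [abs_mul, abs_of_nonneg (by positivity : (0 : ℝ) ≤ (R : ℝ) ^ 2)]
        rw [e, abs_le]
        constructor
        · linarith [neg_abs_le ((R : ℝ) ^ 2 * η h)]
        · linarith [le_abs_self ((R : ℝ) ^ 2 * η h)]
      linarith [le_max_left ((R : ℝ) ^ 2 * |η h|) 1, le_max_right ((R : ℝ) ^ 2 * |η h|) 1]
    have b4 : vnorm p q / (12 * R) * (|(j h : ℝ)| + 1) ≤ max |x| |y| := by
      calc _ = (vnorm p q / (4 * R)) * ((|(j h : ℝ)| + 1) / 3) := by field_simp; norm_num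
        _ ≤ (2 * |(q : ℝ)| / (4 * R)) * max ((R : ℝ) ^ 2 * |η h|) 1 := by gcongr
        _ = (|(q : ℝ)| / (2 * R)) * max ((R : ℝ) ^ 2 * |η h|) 1 := by
          congr 1; field_simp; norm_num
        _ ≤ _ := by
          rw [mul_max_of_nonneg _ _ (by positivity), mul_one]
          exact max_le b1 b2
    rw [hw]
    have hpos : 0 < vnorm p q / (12 * R) * (|(j h : ℝ)| + 1) := by positivity
    calc _ ≤ _ := one_div_le_one_div_of_le hpos b4
      _ = _ := by field_simp
  have hmaps : ∀ h ∈ cell R, j h ∈ Finset.Icc (-((3 * R ^ 2 + 1 : ℕ) : ℤ)) (3 * R ^ 2 + 1 : ℕ) := by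
    intro h hh
    obtain ⟨hR, h1, h2, h3, h4, h5, h6⟩ := facts h hh
    have ha : (0 : ℝ) < h 0 0 := by linarith
    have e1 : |(p : ℝ) / q| ≤ 2 := by rw [abs_div, div_le_iff₀ hq']; exact hpq
    have e2 : (h 0 1 : ℝ) / h 0 0 ≤ 1 := (div_le_one ha).2 h4.le
    have e3 : 0 ≤ (h 0 1 : ℝ) / h 0 0 := by positivity
    rw [abs_le] at e1
    have u : η h ≤ 3 := by simp only [hη]; linarith [e1.2]
    have l : -3 ≤ η h := by simp only [hη]; linarith [e1.1]
    have hRR : (0 : ℝ) ≤ (R : ℝ) ^ 2 := by positivity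
    have f1 := Int.floor_le ((R : ℝ) ^ 2 * η h)
    have f2 := Int.lt_floor_add_one ((R : ℝ) ^ 2 * η h)
    rw [Finset.mem_Icc]
    constructor
    · have : ((-((3 * R ^ 2 + 1 : ℕ) : ℤ) : ℤ) : ℝ) ≤ (j h : ℝ) := by
        push_cast; simp only [hj]; nlinarith
      exact_mod_cast this
    · have : (j h : ℝ) ≤ (((3 * R ^ 2 + 1 : ℕ) : ℤ) : ℝ) := by
        push_cast; simp only [hj]; nlinarith
      exact_mod_cast this
  calc _ ≤ ∑ h ∈ cell R, 12 * R / vnorm p q * (1 / (|(j h : ℝ)| + 1)) := Finset.sum_le_sum hterm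
    _ = 12 * R / vnorm p q * ∑ h ∈ cell R, 1 / (|(j h : ℝ)| + 1) := by rw [Finset.mul_sum]
    _ = 12 * R / vnorm p q * ∑ i ∈ (cell R).image j, 1 / (|(i : ℝ)| + 1) := by
        rw [Finset.sum_image hinj]
    _ ≤ 12 * R / vnorm p q * (2 * (1 + Real.log (((3 * R ^ 2 + 1 : ℕ) : ℝ) + 1))) := by
        refine mul_le_mul_of_nonneg_left ?_ (by positivity)
        refine le_trans ?_ (sum_one_div_abs_add_one_le (3 * R ^ 2 + 1))
        exact Finset.sum_le_sum_of_subset_of_nonneg (Finset.image_subset_iff.2 hmaps)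
          fun i _ _ => by positivity
    _ = _ := by
        rw [cellBound]; push_cast
        rw [show (3 * (R : ℝ) ^ 2 + 1 + 1) = 3 * (R : ℝ) ^ 2 + 2 by ring]; ring

theorem sum_cell_le (R : ℕ) {p q : ℤ} (hpq : ¬(p = 0 ∧ q = 0)) :
    ∑ h ∈ cell R, 1 / vnorm (h 0 0 * p + h 0 1 * q) (h 1 0 * p + h 1 1 * q) ≤
      cellBound R / vnorm p q := by
  rcases lt_or_ge (2 * |(q : ℝ)|) |(p : ℝ)| with h | h
  · exact sum_cell_le_of_small h
  · refine sum_cell_le_of_large (fun hq => hpq ⟨?_, hq⟩) h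
    subst hq
    simpa using h

theorem transpose_mem_cell {R : ℕ} {h : SpecialLinearGroup (Fin 2) ℤ} (hh : h ∈ cell R) :
    h.transpose ∈ cell R := by
  rw [mem_cell] at hh ⊢
  simp only [SpecialLinearGroup.coe_transpose, Matrix.transpose_apply]
  exact ⟨hh.1, hh.2.1, hh.2.2.2, hh.2.2.1⟩

theorem sum_cell_inv_le (R : ℕ) {p q : ℤ} (hpq : ¬(p = 0 ∧ q = 0)) :
    ∑ h ∈ cell R, 1 / vnorm (h⁻¹ 0 0 * p + h⁻¹ 0 1 * q) (h⁻¹ 1 0 * p + h⁻¹ 1 1 * q) ≤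
      cellBound R / vnorm p q := by
  have h1 := sum_cell_le R (p := q) (q := -p) (by
    rintro ⟨rfl, h⟩; exact hpq ⟨by simpa using h, rfl⟩)
  have h2 : vnorm q (-p) = vnorm p q := by simp [vnorm, max_comm]
  rw [h2] at h1
  refine le_of_eq_of_le ?_ h1
  refine Finset.sum_nbij' (fun h => h.transpose) (fun h => h.transpose)
    (fun h hh => transpose_mem_cell hh) (fun h hh => transpose_mem_cell hh)
    (fun h _ => by ext; simp) (fun h _ => by ext; simp) ?_
  intro h _
  have h3 : h⁻¹ 0 0 = h 1 1 := by simp [SpecialLinearGroup.SL2_inv_expl]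
  have h4 : h⁻¹ 0 1 = -h 0 1 := by simp [SpecialLinearGroup.SL2_inv_expl]
  have h5 : h⁻¹ 1 0 = -h 1 0 := by simp [SpecialLinearGroup.SL2_inv_expl]
  have h6 : h⁻¹ 1 1 = h 0 0 := by simp [SpecialLinearGroup.SL2_inv_expl]
  rw [h3, h4, h5, h6]
  simp only [SpecialLinearGroup.coe_transpose, Matrix.transpose_apply]
  congr 1
  rw [vnorm, vnorm, max_comm]
  congr 1
  · congr 2; ring
  · rw [← abs_neg]; congr 1; push_cast; ring

/-- The symmetrised block. -/
noncomputable def block (R : ℕ) : Finset (SpecialLinearGroup (Fin 2) ℤ) :=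
  by classical exact cell R ∪ (cell R).image (·⁻¹)

theorem mem_block {R : ℕ} {h : SpecialLinearGroup (Fin 2) ℤ} :
    h ∈ block R ↔ h ∈ cell R ∨ h⁻¹ ∈ cell R := by
  classical
  simp only [block, Finset.mem_union, Finset.mem_image]
  refine or_congr Iff.rfl ⟨?_, fun hh => ⟨_, hh, inv_inv h⟩⟩
  rintro ⟨g, hg, rfl⟩
  rwa [inv_inv]

theorem inv_mem_block {R : ℕ} {h : SpecialLinearGroup (Fin 2) ℤ} (hh : h ∈ block R) :
    h⁻¹ ∈ block R := by
  rw [mem_block] at hh ⊢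
  rw [inv_inv]
  exact hh.symm

theorem abs_le_of_mem_block {R : ℕ} {h : SpecialLinearGroup (Fin 2) ℤ} (hh : h ∈ block R)
    (i j : Fin 2) : |h i j| ≤ R := by
  rcases mem_block.1 hh with hh | hh
  · exact mem_slBall.1 (Finset.mem_filter.1 hh).1 i j
  · have h1 := mem_slBall.1 (Finset.mem_filter.1 hh).1
    have h2 : h = h⁻¹⁻¹ := (inv_inv h).symm
    rw [h2]
    generalize h⁻¹ = g at h1
    fin_cases i <;> fin_cases j <;> simp [SpecialLinearGroup.SL2_inv_expl, h1]

theorem sum_block_le (R : ℕ) {p q : ℤ} (hpq : ¬(p = 0 ∧ q = 0)) :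
    ∑ h ∈ block R, 1 / vnorm (h 0 0 * p + h 0 1 * q) (h 1 0 * p + h 1 1 * q) ≤
      2 * cellBound R / vnorm p q := by
  classical
  rw [block]
  refine (Finset.sum_union_le_add fun h => ?_).trans ?_
  · exact div_nonneg zero_le_one (vnorm_nonneg _ _)
  · rw [Finset.sum_image (fun _ _ _ _ h => inv_injective h), mul_div_assoc, two_mul]
    exact add_le_add (sum_cell_le R hpq) (sum_cell_inv_le R hpq)

theorem card_cell_le_card_block (R : ℕ) : (cell R).card ≤ (block R).card :=
  Finset.card_le_card fun _ hh => mem_block.2 (Or.inl hh)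

theorem sum_totient_le_card_cell (R : ℕ) :
    ∑ a ∈ Finset.Ioc (R / 2) R, a.totient ≤ (cell R).card := by
  have : ∑ a ∈ Finset.Ioc (R / 2) R, a.totient =
      ((Finset.Ioc (R / 2) R).sigma fun a => (Finset.range a).filter a.Coprime).card := by
    rw [Finset.card_sigma]; rfl
  rw [this]
  refine Finset.card_le_card_of_surjOn
    (fun h : SpecialLinearGroup (Fin 2) ℤ => (⟨(h 0 0).toNat, (h 0 1).toNat⟩ : Σ _ : ℕ, ℕ)) ?_
  rintro ⟨a, b⟩ hab
  simp only [Finset.coe_sigma, Set.mem_sigma_iff, Finset.coe_Ioc, Set.mem_Ioc, Finset.coe_filter,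
    Finset.mem_range, Set.mem_ofPred_eq] at hab
  obtain ⟨⟨ha1, ha2⟩, hba, hcop⟩ := hab
  have ha0 : (0 : ℤ) < a := by omega
  obtain ⟨u, v, huv⟩ : IsCoprime (a : ℤ) b := Nat.isCoprime_iff_coprime.2 hcop
  set c : ℤ := (-v) % a with hc
  have hdvd : (a : ℤ) ∣ 1 + b * c := by
    have h1 : (a : ℤ) ∣ -v - c := Int.dvd_self_sub_of_emod_eq rfl
    have : 1 + b * c = u * a - b * (-v - c) := by linear_combination -huv
    rw [this]
    exact dvd_sub (dvd_mul_left _ _) (h1.mul_left _)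
  obtain ⟨d, hd⟩ := hdvd
  obtain ⟨g, g0, g1, g2⟩ : ∃ g : SpecialLinearGroup (Fin 2) ℤ,
      g 0 0 = a ∧ g 0 1 = b ∧ g 1 0 = c :=
    ⟨⟨!![(a : ℤ), b; c, d], by rw [Matrix.det_fin_two_of]; linarith⟩, rfl, rfl, rfl⟩
  refine ⟨g, ?_, by simp [g0, g1]⟩
  rw [Finset.mem_coe, mem_cell, g0, g1, g2]
  have h1 := Int.emod_nonneg (-v) ha0.ne'
  have h2 := Int.emod_lt_of_pos (-v) ha0
  omega

theorem exists_card_cell_ge {ε : ℝ} (hε : 0 < ε) :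
    ∃ C : ℝ, 0 < C ∧ ∀ R : ℕ, 2 ≤ R → (R : ℝ) ^ 2 ≤ C * (R : ℝ) ^ ε * (cell R).card := by
  obtain ⟨C, hC, h⟩ := Nat.exists_card_divisors_le_rpow hε
  refine ⟨4 * C, by linarith, fun R hR => ?_⟩
  have hR0 : (0 : ℝ) < R := by exact_mod_cast (by omega : 0 < R)
  have h1 : ∀ a ∈ Finset.Ioc (R / 2) R, (R : ℝ) / 2 ≤ C * (R : ℝ) ^ ε * a.totient := by
    intro a ha
    rw [Finset.mem_Ioc] at ha
    have h2 : (a : ℝ) ≤ a.totient * a.divisors.card := by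
      exact_mod_cast Nat.le_totient_mul_card_divisors a
    have h3 := h a (by omega)
    have h4 : (R : ℝ) / 2 ≤ a := by
      rw [div_le_iff₀ two_pos]; exact_mod_cast (by omega : R ≤ a * 2)
    have h5 : (a : ℝ) ≤ R := by exact_mod_cast ha.2
    calc (R : ℝ) / 2 ≤ a.totient * a.divisors.card := h4.trans h2
      _ ≤ a.totient * (C * (R : ℝ) ^ ε) := by
        gcongr
        exact h3.trans (by gcongr)
      _ = _ := by ring
  have h6 : (R : ℝ) / 2 * (R / 2) ≤ C * (R : ℝ) ^ ε * (cell R).card := by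
    calc (R : ℝ) / 2 * (R / 2) ≤ (Finset.Ioc (R / 2) R).card * (R / 2 : ℝ) := by
          gcongr
          rw [Nat.card_Ioc, div_le_iff₀ two_pos]
          exact_mod_cast (by omega : R ≤ (R - R / 2) * 2)
      _ = ∑ a ∈ Finset.Ioc (R / 2) R, (R : ℝ) / 2 := by rw [Finset.sum_const, nsmul_eq_mul]
      _ ≤ ∑ a ∈ Finset.Ioc (R / 2) R, C * (R : ℝ) ^ ε * a.totient := Finset.sum_le_sum h1
      _ = C * (R : ℝ) ^ ε * ((∑ a ∈ Finset.Ioc (R / 2) R, a.totient : ℕ) : ℝ) := by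
          rw [← Finset.mul_sum]; push_cast; rfl
      _ ≤ _ := by
          gcongr
          exact sum_totient_le_card_cell R
  linarith

/-! ### Counting words in the block -/

/-- The number of ways to write `g` as a product of `k` elements of `block R`. -/
noncomputable def wordCount (R : ℕ) : ℕ → SpecialLinearGroup (Fin 2) ℤ → ℝ
  | 0 => Set.indicator {1} 1
  | k + 1 => fun g => ∑ h ∈ block R, wordCount R k (h⁻¹ * g)

theorem wordCount_nonneg (R k : ℕ) (g : SpecialLinearGroup (Fin 2) ℤ) : 0 ≤ wordCount R k g := by
  induction k generalizing g with
  | zero => exact Set.indicator_nonneg (fun _ _ => zero_le_one) g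
  | succ k ih => exact Finset.sum_nonneg fun h _ => ih _

theorem sl2_mul_apply {R : Type*} [CommRing R] (g h : SpecialLinearGroup (Fin 2) R) (i j : Fin 2) :
    (g * h) i j = g i 0 * h 0 j + g i 1 * h 1 j := by
  exact (Matrix.mul_apply).trans (Fin.sum_univ_two _)

theorem mem_slBall_mul {X Y : ℕ} {g h : SpecialLinearGroup (Fin 2) ℤ} (hg : ∀ i j, |g i j| ≤ X)
    (hh : h ∈ slBall Y) : g * h ∈ slBall (2 * X * Y) := by
  rw [mem_slBall] at hh ⊢
  intro i j
  rw [sl2_mul_apply]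
  refine (abs_add_le _ _).trans ?_
  rw [abs_mul, abs_mul]
  have h1 := mul_le_mul (hg i 0) (hh 0 j) (abs_nonneg _) (by positivity)
  have h2 := mul_le_mul (hg i 1) (hh 1 j) (abs_nonneg _) (by positivity)
  push_cast
  linarith

theorem mem_slBall_of_wordCount_ne_zero {R k : ℕ} {g : SpecialLinearGroup (Fin 2) ℤ}
    (h : wordCount R k g ≠ 0) : g ∈ slBall ((2 * R) ^ k) := by
  induction k generalizing g with
  | zero =>
    have : g = 1 := by
      by_contra hg
      exact h (Set.indicator_of_notMem (by simpa using hg) _)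
    subst this
    rw [mem_slBall]
    intro i j
    fin_cases i <;> fin_cases j <;> simp
  | succ k ih =>
    obtain ⟨s, hs, h⟩ := Finset.exists_ne_zero_of_sum_ne_zero h
    have := mem_slBall_mul (fun i j => abs_le_of_mem_block hs i j) (ih h)
    rwa [mul_inv_cancel_left, ← pow_succ'] at this

theorem sum_wordCount_succ {E : Type*} [AddCommGroup E] [Module ℝ E] (R k : ℕ)
    (F : SpecialLinearGroup (Fin 2) ℤ → E) :
    ∑ g ∈ slBall ((2 * R) ^ (k + 1)), wordCount R (k + 1) g • F g =
      ∑ h ∈ block R, ∑ g ∈ slBall ((2 * R) ^ k), wordCount R k g • F (h * g) := by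
  simp only [wordCount, Finset.sum_smul]
  rw [Finset.sum_comm]
  refine Finset.sum_congr rfl fun h hh => ?_
  symm
  refine Finset.sum_of_injOn (fun g => h * g) (fun _ _ _ _ e => mul_left_cancel e) ?_ ?_ ?_
  · intro g hg
    have := mem_slBall_mul (fun i j => abs_le_of_mem_block hh i j) hg
    rwa [← pow_succ'] at this
  · intro g _ hg
    by_contra h0
    exact hg ⟨h⁻¹ * g, mem_slBall_of_wordCount_ne_zero (left_ne_zero_of_smul h0),
      mul_inv_cancel_left _ _⟩
  · intro g _
    simp

theorem column_ne_zero (g : SpecialLinearGroup (Fin 2) ℤ) (j : Fin 2) :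
    ¬(g 0 j = 0 ∧ g 1 j = 0) := by
  rintro ⟨h1, h2⟩
  have := sl2_det g
  fin_cases j <;> simp_all

theorem cellBound_nonneg (R : ℕ) : 0 ≤ cellBound R := by
  have : 0 ≤ Real.log (3 * (R : ℝ) ^ 2 + 2) := Real.log_nonneg (by nlinarith [sq_nonneg (R : ℝ)])
  unfold cellBound; positivity

theorem wordCount_le_column (R k : ℕ) (g : SpecialLinearGroup (Fin 2) ℤ) (j : Fin 2) :
    wordCount R k g ≤ (2 * cellBound R) ^ k / vnorm (g 0 j) (g 1 j) := by
  induction k generalizing g with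
  | zero =>
    by_cases hg : g = 1
    · subst hg
      fin_cases j <;> simp [wordCount, vnorm]
    · rw [wordCount, Set.indicator_of_notMem (by simpa using hg)]
      exact div_nonneg (by simp) (vnorm_nonneg _ _)
  | succ k ih =>
    have h0 := cellBound_nonneg R
    calc wordCount R (k + 1) g
        ≤ ∑ h ∈ block R, (2 * cellBound R) ^ k / vnorm ((h⁻¹ * g) 0 j) ((h⁻¹ * g) 1 j) :=
          Finset.sum_le_sum fun h _ => ih _
      _ = ∑ h ∈ block R, (2 * cellBound R) ^ k *
            (1 / vnorm (h 0 0 * g 0 j + h 0 1 * g 1 j) (h 1 0 * g 0 j + h 1 1 * g 1 j)) := by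
          refine Finset.sum_nbij' (fun h => h⁻¹) (fun h => h⁻¹) (fun h hh => inv_mem_block hh)
            (fun h hh => inv_mem_block hh) (fun h _ => inv_inv h) (fun h _ => inv_inv h) ?_
          intro h _
          rw [sl2_mul_apply, sl2_mul_apply]
          ring
      _ ≤ (2 * cellBound R) ^ k * (2 * cellBound R / vnorm (g 0 j) (g 1 j)) := by
          rw [← Finset.mul_sum]
          exact mul_le_mul_of_nonneg_left (sum_block_le R (column_ne_zero g j)) (by positivity)
      _ = _ := by rw [pow_succ]; ring

/-- The sup norm of a matrix in `SL₂(ℤ)`. -/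
noncomputable def slNorm (g : SpecialLinearGroup (Fin 2) ℤ) : ℝ :=
  max (vnorm (g 0 0) (g 1 0)) (vnorm (g 0 1) (g 1 1))

theorem abs_le_slNorm (g : SpecialLinearGroup (Fin 2) ℤ) (i j : Fin 2) :
    |(g i j : ℝ)| ≤ slNorm g := by
  fin_cases i <;> fin_cases j <;> simp [slNorm, vnorm]

theorem one_le_slNorm (g : SpecialLinearGroup (Fin 2) ℤ) : 1 ≤ slNorm g := by
  have h : 1 ≤ |g 0 0| ∨ 1 ≤ |g 1 0| := by
    by_contra! h
    exact column_ne_zero g 0 ⟨Int.abs_lt_one_iff.1 h.1, Int.abs_lt_one_iff.1 h.2⟩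
  rcases h with h | h
  · exact le_trans (by exact_mod_cast h) (abs_le_slNorm g 0 0)
  · exact le_trans (by exact_mod_cast h) (abs_le_slNorm g 1 0)

theorem wordCount_le (R k : ℕ) (g : SpecialLinearGroup (Fin 2) ℤ) :
    wordCount R k g ≤ (2 * cellBound R) ^ k * (1 / slNorm g) := by
  rw [mul_one_div, slNorm]
  rcases max_choice (vnorm (g 0 0) (g 1 0)) (vnorm (g 0 1) (g 1 1)) with h | h <;> rw [h]
  exacts [wordCount_le_column R k g 0, wordCount_le_column R k g 1]

/-! ### Counting in congruence subgroups -/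

open Classical in
/-- The elements of the principal congruence subgroup with entries bounded by `X`. -/
noncomputable def gammaBall (N X : ℕ) : Finset (SpecialLinearGroup (Fin 2) ℤ) :=
  (slBall X).filter fun g => g ∈ CongruenceSubgroup.Gamma N

theorem mem_gammaBall {N X : ℕ} {g : SpecialLinearGroup (Fin 2) ℤ} :
    g ∈ gammaBall N X ↔ (∀ i j, |g i j| ≤ X) ∧ (N : ℤ) ∣ g 0 0 - 1 ∧ (N : ℤ) ∣ g 0 1 ∧
      (N : ℤ) ∣ g 1 0 ∧ (N : ℤ) ∣ g 1 1 - 1 := by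
  classical
  rw [gammaBall, Finset.mem_filter, mem_slBall, CongruenceSubgroup.Gamma_mem]
  simp only [← ZMod.intCast_zmod_eq_zero_iff_dvd]
  simp [sub_eq_zero]

theorem sq_dvd_trace_sub_two {N X : ℕ} {g : SpecialLinearGroup (Fin 2) ℤ}
    (hg : g ∈ gammaBall N X) : (N : ℤ) ^ 2 ∣ g 0 0 + g 1 1 - 2 := by
  obtain ⟨-, h1, h2, h3, h4⟩ := mem_gammaBall.1 hg
  have e : g 0 0 + g 1 1 - 2 = g 0 1 * g 1 0 - (g 0 0 - 1) * (g 1 1 - 1) := by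
    linear_combination sl2_det g
  rw [e, sq]
  exact dvd_sub (mul_dvd_mul h2 h3) (mul_dvd_mul h1 h4)

theorem card_le_two_mul_card_divisors {s : Finset (SpecialLinearGroup (Fin 2) ℤ)} {a d : ℤ}
    (hM : a * d - 1 ≠ 0) (hs : ∀ g ∈ s, g 0 0 = a ∧ g 1 1 = d) :
    s.card ≤ 2 * (a * d - 1).natAbs.divisors.card := by
  classical
  set V := (a * d - 1).natAbs.divisors
  calc s.card ≤ (V.image (fun n : ℕ => (n : ℤ)) ∪ V.image (fun n : ℕ => -(n : ℤ))).card := by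
        refine Finset.card_le_card_of_injOn (fun g => g 0 1) ?_ ?_
        · intro g hg
          obtain ⟨h1, h2⟩ := hs g hg
          have hd := sl2_det g
          have hdvd : (g 0 1).natAbs ∈ V := by
            rw [Nat.mem_divisors, Int.natAbs_dvd_natAbs]
            exact ⟨⟨g 1 0, by rw [h1, h2] at hd; linarith⟩, by simpa using hM⟩
          simp only [Finset.coe_union, Finset.coe_image, Set.mem_union, Set.mem_image,
            Finset.mem_coe]
          rcases Int.natAbs_eq (g 0 1) with h | h
          · exact Or.inl ⟨_, hdvd, h.symm⟩
          · exact Or.inr ⟨_, hdvd, h.symm⟩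
        · intro g hg g' hg' hb
          obtain ⟨h1, h2⟩ := hs g hg
          obtain ⟨h1', h2'⟩ := hs g' hg'
          have hd := sl2_det g
          have hd' := sl2_det g'
          simp only at hb
          refine sl2_ext (h1.trans h1'.symm) hb ?_ (h2.trans h2'.symm)
          rw [h1, h2] at hd
          rw [h1', h2', ← hb] at hd'
          have hb0 : g 0 1 ≠ 0 := by
            intro h0
            rw [h0] at hd
            exact hM (by linarith)
          exact mul_left_cancel₀ hb0 (by linarith)
    _ ≤ V.card + V.card := (Finset.card_union_le _ _).trans
        (add_le_add Finset.card_image_le Finset.card_image_le)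
    _ = _ := (two_mul _).symm

theorem one_div_abs_le_two_div {j : ℤ} (hj : j ≠ 0) : 1 / |(j : ℝ)| ≤ 2 * (1 / (|(j : ℝ)| + 1)) := by
  have : (1 : ℝ) ≤ |(j : ℝ)| := by exact_mod_cast Int.one_le_abs hj
  rw [mul_one_div, div_le_div_iff₀ (by linarith) (by linarith)]
  linarith

theorem sum_fiber_le_of_ne {s : Finset (SpecialLinearGroup (Fin 2) ℤ)} {a d : ℤ}
    {D c : ℝ} (hM : a * d - 1 ≠ 0) (hs : ∀ g ∈ s, g 0 0 = a ∧ g 1 1 = d)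
    (hD : ((a * d - 1).natAbs.divisors.card : ℝ) ≤ D) (hc : 0 < c)
    (hm : ∀ g ∈ s, c ≤ slNorm g) :
    ∑ g ∈ s, 1 / slNorm g ≤ 2 * D * (1 / c) := by
  calc ∑ g ∈ s, 1 / slNorm g ≤ ∑ g ∈ s, 1 / c :=
        Finset.sum_le_sum fun g hg => one_div_le_one_div_of_le hc (hm g hg)
    _ = s.card * (1 / c) := by rw [Finset.sum_const, nsmul_eq_mul]
    _ ≤ 2 * D * (1 / c) := by
        refine mul_le_mul_of_nonneg_right ?_ (by positivity)
        have : (s.card : ℝ) ≤ 2 * ((a * d - 1).natAbs.divisors.card : ℝ) := by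
          exact_mod_cast card_le_two_mul_card_divisors hM hs
        linarith

theorem sum_unipotent_le {X : ℕ} {s : Finset (SpecialLinearGroup (Fin 2) ℤ)}
    (hs : ∀ g ∈ s, (∀ i j, |g i j| ≤ X) ∧ g 0 0 = 1 ∧ g 1 1 = 1) :
    ∑ g ∈ s, 1 / slNorm g ≤ 8 * (1 + Real.log (X + 1)) := by
  classical
  have key : ∀ (i j : Fin 2) (t : Finset (SpecialLinearGroup (Fin 2) ℤ)), t ⊆ s →
      Set.InjOn (fun g : SpecialLinearGroup (Fin 2) ℤ => g i j) t →
      ∑ g ∈ t, 1 / slNorm g ≤ 4 * (1 + Real.log (X + 1)) := by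
    intro i j t ht hinj
    calc ∑ g ∈ t, 1 / slNorm g ≤ ∑ g ∈ t, 2 * (1 / (|((g i j : ℤ) : ℝ)| + 1)) := by
          refine Finset.sum_le_sum fun g _ => ?_
          have h1 := one_le_slNorm g
          have h2 := abs_le_slNorm g i j
          rw [mul_one_div, div_le_div_iff₀ (by linarith) (by positivity)]
          linarith
      _ = 2 * ∑ b ∈ t.image (fun g => g i j), 1 / (|((b : ℤ) : ℝ)| + 1) := by
          rw [Finset.sum_image hinj, Finset.mul_sum]
      _ ≤ 2 * ∑ b ∈ Finset.Icc (-(X : ℤ)) X, 1 / (|((b : ℤ) : ℝ)| + 1) := by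
          refine mul_le_mul_of_nonneg_left (Finset.sum_le_sum_of_subset_of_nonneg ?_ ?_) (by simp)
          · intro b hb
            obtain ⟨g, hg, rfl⟩ := Finset.mem_image.1 hb
            exact Finset.mem_Icc.2 (abs_le.1 ((hs g (ht hg)).1 i j))
          · intro b _ _
            positivity
      _ ≤ _ := by linarith [sum_one_div_abs_add_one_le X]
  have hcover : s = s.filter (fun g => g 1 0 = 0) ∪ s.filter (fun g => g 0 1 = 0) := by
    ext g
    simp only [Finset.mem_union, Finset.mem_filter]
    refine ⟨fun hg => ?_, fun hg => by tauto⟩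
    have hd := sl2_det g
    rw [(hs g hg).2.1, (hs g hg).2.2] at hd
    rcases mul_eq_zero.1 (show g 0 1 * g 1 0 = 0 by linarith) with h | h <;> tauto
  rw [hcover]
  refine (Finset.sum_union_le_add fun g => ?_).trans ((add_le_add
    (key 0 1 _ (Finset.filter_subset _ _) ?_) (key 1 0 _ (Finset.filter_subset _ _) ?_)).trans
    (by linarith))
  · exact div_nonneg zero_le_one (zero_le_one.trans (one_le_slNorm g))
  · intro g hg g' hg' h
    rw [Finset.mem_coe, Finset.mem_filter] at hg hg'
    exact sl2_ext ((hs g hg.1).2.1.trans (hs g' hg'.1).2.1.symm) h (hg.2.trans hg'.2.symm)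
      ((hs g hg.1).2.2.trans (hs g' hg'.1).2.2.symm)
  · intro g hg g' hg' h
    rw [Finset.mem_coe, Finset.mem_filter] at hg hg'
    exact sl2_ext ((hs g hg.1).2.1.trans (hs g' hg'.1).2.1.symm) (hg.2.trans hg'.2.symm) h
      ((hs g hg.1).2.2.trans (hs g' hg'.1).2.2.symm)

theorem sum_gammaBall_fiber_le {N X : ℕ} {D : ℝ} (hN : 3 ≤ N)
    (hD : ∀ M : ℕ, M ≠ 0 → M ≤ X ^ 2 → (M.divisors.card : ℝ) ≤ D) (hD1 : 1 ≤ D)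
    {s : Finset (SpecialLinearGroup (Fin 2) ℤ)} (hsX : s ⊆ gammaBall N X) {α β : ℤ}
    (hs : ∀ g ∈ s, g 0 0 = 1 + N * α ∧ g 0 0 + g 1 1 = 2 + (N : ℤ) ^ 2 * β) :
    ∑ g ∈ s, 1 / slNorm g ≤ 16 * D / N ^ 2 * (1 / (|(β : ℝ)| + 1)) +
      if β = 0 then 8 * D / N * (1 / (|(α : ℝ)| + 1)) +
        if α = 0 then 8 * (1 + Real.log (X + 1)) else 0 else 0 := by
  have hN0 : (0 : ℝ) < N := by exact_mod_cast (by omega : 0 < N)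
  have hlog : 0 ≤ Real.log ((X : ℝ) + 1) := Real.log_nonneg (by simp)
  rcases s.eq_empty_or_nonempty with rfl | ⟨g₀, hg₀⟩
  · rw [Finset.sum_empty]
    split_ifs <;> positivity
  set a : ℤ := 1 + N * α with ha
  set d : ℤ := 1 + (N : ℤ) ^ 2 * β - N * α with hd
  have hs' : ∀ g ∈ s, g 0 0 = a ∧ g 1 1 = d := fun g hg => by
    obtain ⟨h1, h2⟩ := hs g hg
    exact ⟨h1, by rw [h1] at h2; rw [hd]; linarith⟩
  have hDM : a * d - 1 ≠ 0 → (((a * d - 1).natAbs.divisors.card : ℕ) : ℝ) ≤ D := by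
    intro h0
    refine hD _ (by simpa using h0) ?_
    have hb := (mem_gammaBall.1 (hsX hg₀)).1
    have hdet := sl2_det g₀
    rw [(hs' g₀ hg₀).1, (hs' g₀ hg₀).2] at hdet
    zify
    rw [show a * d - 1 = g₀ 0 1 * g₀ 1 0 by linarith, abs_mul, sq]
    exact mul_le_mul (hb 0 1) (hb 1 0) (abs_nonneg _) (by positivity)
  by_cases hβ : β = 0
  · rw [if_pos hβ]
    refine le_add_of_nonneg_of_le (by positivity) ?_
    by_cases hα : α = 0
    · rw [if_pos hα]
      refine le_add_of_nonneg_of_le (by positivity) (sum_unipotent_le fun g hg => ?_)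
      refine ⟨(mem_gammaBall.1 (hsX hg)).1, (hs' g hg).1.trans ?_, (hs' g hg).2.trans ?_⟩
      · rw [ha, hα]; simp
      · rw [hd, hα, hβ]; simp
    · rw [if_neg hα, add_zero]
      have hM : a * d - 1 ≠ 0 := by
        have : a * d - 1 = -((N : ℤ) * α) ^ 2 := by rw [ha, hd, hβ]; ring
        rw [this, neg_ne_zero]
        exact pow_ne_zero _ (mul_ne_zero (by omega) hα)
      have hα1 : (1 : ℝ) ≤ |(α : ℝ)| := by exact_mod_cast Int.one_le_abs hα
      refine (sum_fiber_le_of_ne (c := N * |(α : ℝ)| / 2) hM hs' (hDM hM)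
        (by positivity) fun g hg => ?_).trans ?_
      · have h1 := abs_le_slNorm g 0 0
        have h2 := one_le_slNorm g
        rw [(hs' g hg).1, ha] at h1
        push_cast at h1
        have h3 := abs_sub (1 + (N : ℝ) * α) 1
        rw [add_sub_cancel_left, abs_mul, Nat.abs_cast, abs_one] at h3
        linarith
      · have := one_div_abs_le_two_div hα
        calc 2 * D * (1 / (N * |(α : ℝ)| / 2)) = 4 * D / N * (1 / |(α : ℝ)|) := by
              field_simp; ring
          _ ≤ 4 * D / N * (2 * (1 / (|(α : ℝ)| + 1))) :=
              mul_le_mul_of_nonneg_left this (by positivity)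
          _ = _ := by ring
  · rw [if_neg hβ, add_zero]
    have hM : a * d - 1 ≠ 0 := by
      intro h
      have h9 : (9 : ℤ) ≤ (N : ℤ) ^ 2 := by
        have : (3 : ℤ) ≤ N := by exact_mod_cast hN
        nlinarith
      have hsum : a + d = 2 + (N : ℤ) ^ 2 * β := by rw [ha, hd]; ring
      have hb9 : 9 ≤ |(N : ℤ) ^ 2 * β| := by
        rw [abs_mul, abs_of_nonneg (by positivity)]
        nlinarith [Int.one_le_abs hβ]
      rcases Int.mul_eq_one_iff_eq_one_or_neg_one.1 (show a * d = 1 by linarith) with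
        ⟨h1, h2⟩ | ⟨h1, h2⟩ <;> rw [h1, h2] at hsum
      · rw [show (N : ℤ) ^ 2 * β = 0 by linarith] at hb9; simp at hb9
      · rw [show (N : ℤ) ^ 2 * β = -4 by linarith] at hb9; norm_num at hb9
    have hβ1 : (1 : ℝ) ≤ |(β : ℝ)| := by exact_mod_cast Int.one_le_abs hβ
    refine (sum_fiber_le_of_ne (c := N ^ 2 * |(β : ℝ)| / 4) hM hs' (hDM hM)
      (by positivity) fun g hg => ?_).trans ?_
    · have h1 := abs_le_slNorm g 0 0
      have h1' := abs_le_slNorm g 1 1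
      have h2 := one_le_slNorm g
      have h3 : ((g 0 0 : ℤ) : ℝ) + (g 1 1 : ℤ) = 2 + (N : ℝ) ^ 2 * β := by
        exact_mod_cast (hs g hg).2
      have h4 : |(N : ℝ) ^ 2 * β| ≤ 4 * slNorm g := by
        rw [abs_le] at h1 h1' ⊢
        constructor <;> linarith
      rw [abs_mul, abs_of_nonneg (by positivity)] at h4
      linarith
    · have := one_div_abs_le_two_div hβ
      calc 2 * D * (1 / (N ^ 2 * |(β : ℝ)| / 4)) = 8 * D / N ^ 2 * (1 / |(β : ℝ)|) := by
            field_simp; ring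
        _ ≤ 8 * D / N ^ 2 * (2 * (1 / (|(β : ℝ)| + 1))) :=
            mul_le_mul_of_nonneg_left this (by positivity)
        _ = _ := by ring

theorem sum_gammaBall_le_of_card_divisors_le {N X : ℕ} {D : ℝ} (hN : 3 ≤ N) (hX : N ^ 3 ≤ X)
    (hD : ∀ M : ℕ, M ≠ 0 → M ≤ X ^ 2 → (M.divisors.card : ℝ) ≤ D) (hD1 : 1 ≤ D) :
    ∑ g ∈ gammaBall N X, 1 / slNorm g ≤ 184 * D * (1 + Real.log (X + 1)) * (X / N ^ 3) := by
  have hN0 : (0 : ℝ) < N := by exact_mod_cast (by omega : 0 < N)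
  have hlog : 0 ≤ Real.log ((X : ℝ) + 1) := Real.log_nonneg (by simp)
  have hXN : (N : ℝ) ^ 3 ≤ X := by exact_mod_cast hX
  have hN3 : (3 : ℝ) ≤ N := by exact_mod_cast hN
  set I := 2 * X / N with hI
  have hIX : I ≤ X := by
    rw [hI]; exact Nat.div_le_of_le_mul (Nat.mul_le_mul_right _ (by omega))
  set L := 1 + Real.log ((X : ℝ) + 1)
  have hL1 : 1 ≤ L := by linarith
  have hX1 : 1 ≤ X := le_trans (Nat.one_le_pow _ _ (by omega)) hX
  let φ : SpecialLinearGroup (Fin 2) ℤ → ℤ × ℤ :=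
    fun g => ((g 0 0 + g 1 1 - 2) / (N : ℤ) ^ 2, (g 0 0 - 1) / N)
  have hφ : ∀ g ∈ gammaBall N X, g 0 0 = 1 + N * (φ g).2 ∧
      g 0 0 + g 1 1 = 2 + (N : ℤ) ^ 2 * (φ g).1 := by
    intro g hg
    have h1 := Int.mul_ediv_cancel' (sq_dvd_trace_sub_two hg)
    have h2 := Int.mul_ediv_cancel' (mem_gammaBall.1 hg).2.1
    exact ⟨by simp only [φ]; linarith, by simp only [φ]; linarith⟩
  have hmaps : ∀ g ∈ gammaBall N X, φ g ∈ Finset.Icc (-(X : ℤ)) X ×ˢ Finset.Icc (-(I : ℤ)) I := by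
    intro g hg
    obtain ⟨h1, h2⟩ := hφ g hg
    have hb := (mem_gammaBall.1 hg).1
    have hb0 := abs_le.1 (hb 0 0)
    have hb1 := abs_le.1 (hb 1 1)
    rw [Finset.mem_product, Finset.mem_Icc, Finset.mem_Icc, ← abs_le, ← abs_le]
    constructor
    · have : |(N : ℤ) ^ 2 * (φ g).1| ≤ 4 * X := by
        rw [abs_le]
        constructor <;>
          linarith [hb0.1, hb0.2, hb1.1, hb1.2, (by exact_mod_cast hX1 : (1 : ℤ) ≤ X)]
      rw [abs_mul, abs_of_nonneg (by positivity)] at this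
      have h9 : (9 : ℤ) ≤ (N : ℤ) ^ 2 := by
        have : (3 : ℤ) ≤ N := by exact_mod_cast hN
        nlinarith
      nlinarith [abs_nonneg (φ g).1]
    · have : |(N : ℤ) * (φ g).2| ≤ 2 * X := by
        rw [abs_le]; constructor <;> linarith [(by exact_mod_cast hX1 : (1 : ℤ) ≤ X)]
      rw [abs_mul, Nat.abs_cast] at this
      rw [hI]
      push_cast
      exact (Int.le_ediv_iff_mul_le (by omega)).2 (by linarith)
  have h2I : (2 * (I : ℝ) + 1) ≤ 5 * (X / N) := by
    have h1 : (I : ℝ) ≤ 2 * X / N := by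
      rw [hI]; exact_mod_cast Nat.cast_div_le (α := ℝ) (m := 2 * X) (n := N)
    have h2 : (1 : ℝ) ≤ X / N := by
      rw [one_le_div hN0]
      nlinarith [pow_le_pow_right₀ (by linarith : (1 : ℝ) ≤ N) (by norm_num : 1 ≤ 3)]
    rw [mul_div_assoc] at h1
    linarith
  have hsumX := sum_one_div_abs_add_one_le X
  have hsumI : ∑ j ∈ Finset.Icc (-(I : ℤ)) I, 1 / (|(j : ℝ)| + 1) ≤ 2 * L := by
    refine (sum_one_div_abs_add_one_le I).trans ?_
    have : Real.log ((I : ℝ) + 1) ≤ Real.log ((X : ℝ) + 1) :=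
      Real.log_le_log (by positivity) (by exact_mod_cast Nat.succ_le_succ hIX)
    linarith
  have hY1 : (1 : ℝ) ≤ X / N ^ 3 := by rwa [one_le_div (by positivity)]
  calc ∑ g ∈ gammaBall N X, 1 / slNorm g
      = ∑ p ∈ Finset.Icc (-(X : ℤ)) X ×ˢ Finset.Icc (-(I : ℤ)) I,
          ∑ g ∈ (gammaBall N X).filter (fun g => φ g = p), 1 / slNorm g :=
        (Finset.sum_fiberwise_of_maps_to hmaps _).symm
    _ ≤ ∑ p ∈ Finset.Icc (-(X : ℤ)) X ×ˢ Finset.Icc (-(I : ℤ)) I,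
          (16 * D / N ^ 2 * (1 / (|(p.1 : ℝ)| + 1)) +
          if p.1 = 0 then 8 * D / N * (1 / (|(p.2 : ℝ)| + 1)) +
            if p.2 = 0 then 8 * L else 0 else 0) := by
        refine Finset.sum_le_sum fun p _ => sum_gammaBall_fiber_le hN hD hD1
          (Finset.filter_subset _ _) fun g hg => ?_
        obtain ⟨hg', rfl⟩ := Finset.mem_filter.1 hg
        exact hφ g hg'
    _ = (2 * (I : ℝ) + 1) * (16 * D / N ^ 2 *
          ∑ β ∈ Finset.Icc (-(X : ℤ)) X, (1 / (|(β : ℝ)| + 1))) +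
        (8 * D / N * ∑ α ∈ Finset.Icc (-(I : ℤ)) I, (1 / (|(α : ℝ)| + 1)) + 8 * L) := by
        rw [Finset.sum_add_distrib, Finset.sum_product, Finset.sum_product_right]
        congr 1
        · simp only [Finset.sum_const, Int.card_Icc, nsmul_eq_mul, Finset.mul_sum]
          refine Finset.sum_congr rfl fun β _ => ?_
          have : ((((I : ℤ) + 1 - -(I : ℤ)).toNat : ℕ) : ℝ) = 2 * I + 1 := by
            rw [show ((I : ℤ) + 1 - -(I : ℤ)).toNat = 2 * I + 1 by omega]; push_cast; ring
          rw [this]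
        · simp only [Finset.sum_ite_eq', Finset.mem_Icc]
          have h0 : -(X : ℤ) ≤ 0 ∧ (0 : ℤ) ≤ X := by simp
          simp only [if_pos h0]
          rw [Finset.sum_add_distrib, Finset.mul_sum]
          simp
    _ ≤ 5 * (X / N) * (16 * D / N ^ 2 * (2 * L)) + (8 * D / N * (2 * L) + 8 * L) := by
        refine add_le_add (mul_le_mul h2I ?_ ?_ (by positivity)) (add_le_add ?_ le_rfl)
        · exact mul_le_mul_of_nonneg_left hsumX (by positivity)
        · exact mul_nonneg (by positivity) (Finset.sum_nonneg fun _ _ => by positivity)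
        · exact mul_le_mul_of_nonneg_left hsumI (by positivity)
    _ ≤ 184 * D * L * (X / N ^ 3) := by
        have e1 : 5 * ((X : ℝ) / N) * (16 * D / N ^ 2 * (2 * L)) = 160 * D * L * (X / N ^ 3) := by
          field_simp; ring
        have e2 : 8 * D / N * (2 * L) ≤ 16 * D * L * (X / N ^ 3) := by
          have : 8 * D / N * (2 * L) ≤ 16 * D * L := by
            rw [div_mul_eq_mul_div, div_le_iff₀ hN0]
            nlinarith [mul_nonneg (by linarith : 0 ≤ D) (by linarith : 0 ≤ L)]
          exact this.trans (le_mul_of_one_le_right (by positivity) hY1)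
        have e3 : 8 * L ≤ 8 * D * L * (X / N ^ 3) := by
          have : 8 * L ≤ 8 * D * L := by nlinarith
          exact this.trans (le_mul_of_one_le_right (by positivity) hY1)
        rw [e1]
        linarith

theorem exists_sum_gammaBall_le {ε : ℝ} (hε : 0 < ε) : ∃ C > 0, ∀ N X : ℕ, 3 ≤ N → N ^ 3 ≤ X →
    ∑ g ∈ gammaBall N X, 1 / slNorm g ≤ C * (X : ℝ) ^ ε * (X / N ^ 3) := by
  obtain ⟨C, hC1, hC⟩ := Nat.exists_card_divisors_le_rpow (show 0 < ε / 4 by positivity)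
  refine ⟨184 * C * (1 + 4 / ε * 2 ^ (ε / 2)), by positivity, fun N X hN hX => ?_⟩
  have hX1 : 1 ≤ X := le_trans (Nat.one_le_pow _ _ (by omega)) hX
  have hX1' : (1 : ℝ) ≤ X := by exact_mod_cast hX1
  have hX0 : (0 : ℝ) < X := by linarith
  have hXe : (1 : ℝ) ≤ (X : ℝ) ^ (ε / 2) := Real.one_le_rpow hX1' (by positivity)
  refine (sum_gammaBall_le_of_card_divisors_le (D := C * (X : ℝ) ^ (ε / 2)) hN hX ?_ ?_).trans ?_
  · intro M hM hMX
    refine (hC M hM).trans (mul_le_mul_of_nonneg_left ?_ (by linarith))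
    calc (M : ℝ) ^ (ε / 4) ≤ ((X : ℝ) ^ (2 : ℝ)) ^ (ε / 4) := by
          refine Real.rpow_le_rpow (by positivity) ?_ (by positivity)
          exact_mod_cast hMX
      _ = (X : ℝ) ^ (ε / 2) := by
          rw [← Real.rpow_mul hX0.le]; ring_nf
  · nlinarith
  · have hlog : Real.log ((X : ℝ) + 1) ≤ 4 / ε * 2 ^ (ε / 2) * (X : ℝ) ^ (ε / 2) := by
      have h1 := Real.log_le_rpow_div (x := (X : ℝ) + 1) (by positivity)
        (show 0 < ε / 2 by positivity)
      have h2 : ((X : ℝ) + 1) ^ (ε / 2) ≤ 2 ^ (ε / 2) * (X : ℝ) ^ (ε / 2) := by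
        rw [← Real.mul_rpow (by norm_num) hX0.le]
        exact Real.rpow_le_rpow (by positivity) (by linarith) (by positivity)
      calc _ ≤ _ := h1
        _ ≤ 2 ^ (ε / 2) * (X : ℝ) ^ (ε / 2) / (ε / 2) := by gcongr
        _ = 2 / ε * 2 ^ (ε / 2) * (X : ℝ) ^ (ε / 2) := by field_simp
        _ ≤ _ := by gcongr; norm_num
    have hL : 1 + Real.log ((X : ℝ) + 1) ≤
        (1 + 4 / ε * 2 ^ (ε / 2)) * (X : ℝ) ^ (ε / 2) := by linarith
    have hsplit : (X : ℝ) ^ ε = (X : ℝ) ^ (ε / 2) * (X : ℝ) ^ (ε / 2) := by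
      rw [← Real.rpow_add hX0]; ring_nf
    rw [hsplit]
    refine mul_le_mul_of_nonneg_right ?_ (by positivity)
    calc 184 * (C * (X : ℝ) ^ (ε / 2)) * (1 + Real.log ((X : ℝ) + 1)) ≤
        184 * (C * (X : ℝ) ^ (ε / 2)) * ((1 + 4 / ε * 2 ^ (ε / 2)) * (X : ℝ) ^ (ε / 2)) :=
          mul_le_mul_of_nonneg_left hL (by positivity)
      _ = _ := by ring

/-! ### Elementary matrices -/

section Elementary

variable {R : Type*} [CommRing R]

/-- The upper unipotent matrix with corner `b`. -/
def upperSL (b : R) : SpecialLinearGroup (Fin 2) R := ⟨!![1, b; 0, 1], by simp⟩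

/-- The lower unipotent matrix with corner `b`. -/
def lowerSL (b : R) : SpecialLinearGroup (Fin 2) R := ⟨!![1, 0; b, 1], by simp⟩

/-- The diagonal matrix with entries `t⁻¹` and `t`. -/
def diagSL (t : Rˣ) : SpecialLinearGroup (Fin 2) R := ⟨!![((t⁻¹ : Rˣ) : R), 0; 0, (t : R)], by simp⟩

@[simp] theorem upperSL_apply_00 (b : R) : upperSL b 0 0 = 1 := rfl
@[simp] theorem upperSL_apply_01 (b : R) : upperSL b 0 1 = b := rfl
@[simp] theorem upperSL_apply_10 (b : R) : upperSL b 1 0 = 0 := rfl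
@[simp] theorem upperSL_apply_11 (b : R) : upperSL b 1 1 = 1 := rfl
@[simp] theorem lowerSL_apply_00 (b : R) : lowerSL b 0 0 = 1 := rfl
@[simp] theorem lowerSL_apply_01 (b : R) : lowerSL b 0 1 = 0 := rfl
@[simp] theorem lowerSL_apply_10 (b : R) : lowerSL b 1 0 = b := rfl
@[simp] theorem lowerSL_apply_11 (b : R) : lowerSL b 1 1 = 1 := rfl
@[simp] theorem diagSL_apply_00 (t : Rˣ) : diagSL t 0 0 = ((t⁻¹ : Rˣ) : R) := rfl
@[simp] theorem diagSL_apply_01 (t : Rˣ) : diagSL t 0 1 = 0 := rfl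
@[simp] theorem diagSL_apply_10 (t : Rˣ) : diagSL t 1 0 = 0 := rfl
@[simp] theorem diagSL_apply_11 (t : Rˣ) : diagSL t 1 1 = t := rfl

theorem upperSL_mul (a b : R) : upperSL a * upperSL b = upperSL (a + b) := by
  apply sl2_ext <;> simp [sl2_mul_apply, add_comm]

theorem lowerSL_mul (a b : R) : lowerSL a * lowerSL b = lowerSL (a + b) := by
  apply sl2_ext <;> simp [sl2_mul_apply]

theorem upperSL_zero : upperSL (0 : R) = 1 := by
  apply sl2_ext <;> simp

theorem lowerSL_zero : lowerSL (0 : R) = 1 := by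
  apply sl2_ext <;> simp

theorem upperSL_pow (a : R) (n : ℕ) : upperSL a ^ n = upperSL (n * a) := by
  induction n with
  | zero => simp [upperSL_zero]
  | succ n ih => rw [pow_succ, ih, upperSL_mul]; push_cast; ring_nf

theorem lowerSL_pow (a : R) (n : ℕ) : lowerSL a ^ n = lowerSL (n * a) := by
  induction n with
  | zero => simp [lowerSL_zero]
  | succ n ih => rw [pow_succ, ih, lowerSL_mul]; push_cast; ring_nf

theorem upperSL_mul_diagSL (t : Rˣ) (b : R) :
    upperSL b * diagSL t = diagSL t * upperSL (t ^ 2 * b) := by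
  apply sl2_ext <;> simp [sl2_mul_apply]
  rw [pow_two, mul_assoc, Units.inv_mul_cancel_left, mul_comm]

theorem sl2_det' (h : SpecialLinearGroup (Fin 2) R) : h 0 0 * h 1 1 - h 0 1 * h 1 0 = 1 := by
  have := h.det_coe
  rwa [Matrix.det_fin_two] at this

/-- Matrices with the same invertible upper left entry differ by elementary matrices. -/
theorem eq_lowerSL_mul_mul_upperSL {g c : SpecialLinearGroup (Fin 2) R} {t : Rˣ}
    (hg : g 0 0 = t) (hc : c 0 0 = t) :
    g = lowerSL ((g 1 0 - c 1 0) * ((t⁻¹ : Rˣ) : R)) * c *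
      upperSL ((g 0 1 - c 0 1) * ((t⁻¹ : Rˣ) : R)) := by
  set s := ((t⁻¹ : Rˣ) : R)
  have hs : s * t = 1 := t.inv_mul
  have h1 := sl2_det' g
  have h2 := sl2_det' c
  rw [hg] at h1
  rw [hc] at h2
  apply sl2_ext <;> simp [sl2_mul_apply, hg, hc]
  · linear_combination (-(g 0 1 - c 0 1)) * hs
  · linear_combination (-(g 1 0 - c 1 0)) * hs
  · linear_combination s * h1 - s * h2 - (g 1 1 - c 1 1 + (g 1 0 - c 1 0) * (g 0 1 - c 0 1) * s) * hs

/-- The principal congruence subgroup of level `m`. -/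
def principalSL (m : R) : Subgroup (SpecialLinearGroup (Fin 2) R) :=
  (SpecialLinearGroup.map (Ideal.Quotient.mk (Ideal.span {m}))).ker

theorem mem_principalSL {m : R} {g : SpecialLinearGroup (Fin 2) R} :
    g ∈ principalSL m ↔ m ∣ g 0 0 - 1 ∧ m ∣ g 0 1 ∧ m ∣ g 1 0 ∧ m ∣ g 1 1 - 1 := by
  simp only [← Ideal.mem_span_singleton, ← Ideal.Quotient.eq_zero_iff_mem, map_sub, map_one,
    sub_eq_zero]
  rw [principalSL, MonoidHom.mem_ker]
  constructor
  · intro h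
    have e := fun i j => congrFun (congrFun (congrArg Subtype.val h) i) j
    exact ⟨by simpa using e 0 0, by simpa using e 0 1, by simpa using e 1 0, by simpa using e 1 1⟩
  · rintro ⟨h1, h2, h3, h4⟩
    apply sl2_ext <;> simpa

/-- The normal closure of `upperSL M` under a large enough congruence subgroup. -/
theorem principalSL_le_of_upperSL_mem {M e : R} (hee : e * e = e) (heM : e * M = M)
    (hcyc : ∀ x : R, ∃ n : ℕ, x = n)
    (hunit : ∀ g ∈ principalSL M, IsUnit (g 0 0) ∨ IsUnit ((upperSL M * g) 0 0))
    {H : Subgroup (SpecialLinearGroup (Fin 2) R)}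
    (hH : ∀ k ∈ principalSL e, ∀ h ∈ H, k * h * k⁻¹ ∈ H) (hM : upperSL M ∈ H) :
    principalSL M ≤ H := by
  have hup : ∀ x : R, upperSL (x * M) ∈ H := by
    intro x
    obtain ⟨n, rfl⟩ := hcyc x
    rw [← upperSL_pow]
    exact H.pow_mem hM n
  have hw : lowerSL (-M) ∈ H := by
    obtain ⟨w, hw00, hw01, hw10, hw11⟩ : ∃ w : SpecialLinearGroup (Fin 2) R,
        w 0 0 = 1 - e ∧ w 0 1 = e ∧ w 1 0 = -e ∧ w 1 1 = 1 - e :=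
      ⟨⟨!![1 - e, e; -e, 1 - e], by
        rw [Matrix.det_fin_two_of]; linear_combination 2 * hee⟩, rfl, rfl, rfl, rfl⟩
    have hwe : w ∈ principalSL e := by
      rw [mem_principalSL, hw00, hw01, hw10, hw11]
      exact ⟨⟨-1, by ring⟩, dvd_rfl, ⟨-1, by ring⟩, ⟨-1, by ring⟩⟩
    have := hH w hwe _ hM
    have he : w * upperSL M * w⁻¹ = lowerSL (-M) := by
      rw [mul_inv_eq_iff_eq_mul]
      apply sl2_ext <;> simp [sl2_mul_apply, hw00, hw01, hw10, hw11]
      · linear_combination -heM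
      · linear_combination -heM
      · ring
    rwa [he] at this
  have hlow : ∀ x : R, lowerSL (x * M) ∈ H := by
    intro x
    obtain ⟨n, hn⟩ := hcyc (-x)
    have : lowerSL (x * M) = lowerSL (-M) ^ n := by
      rw [lowerSL_pow, ← hn]; ring_nf
    rw [this]
    exact H.pow_mem hw n
  have key : ∀ g ∈ principalSL M, IsUnit (g 0 0) → g ∈ H := by
    rintro g hg ⟨t, ht⟩
    obtain ⟨⟨α, h1⟩, ⟨β, h2⟩, ⟨γ, h3⟩, -⟩ := mem_principalSL.1 hg
    have hα : lowerSL (-α * e) ∈ principalSL e := by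
      rw [mem_principalSL]; simp
    have hc := hH _ hα _ hM
    set c := lowerSL (-α * e) * upperSL M * (lowerSL (-α * e))⁻¹ with hcdef
    have hinv : (lowerSL (-α * e))⁻¹ = lowerSL (α * e) := by
      rw [inv_eq_iff_mul_eq_one, lowerSL_mul, ← lowerSL_zero]; ring_nf
    rw [hinv] at hcdef
    have c00 : c 0 0 = t := by
      rw [ht, hcdef]; simp [sl2_mul_apply]; linear_combination α * heM - h1
    have c01 : c 0 1 = M := by rw [hcdef]; simp [sl2_mul_apply]
    have c10 : c 1 0 = -α ^ 2 * M := by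
      rw [hcdef]; simp [sl2_mul_apply]; linear_combination (-α ^ 2 * e - α ^ 2) * heM
    rw [eq_lowerSL_mul_mul_upperSL ht.symm c00, c01, c10, h2, h3]
    refine H.mul_mem (H.mul_mem ?_ hc) ?_
    · convert hlow ((γ + α ^ 2) * ((t⁻¹ : Rˣ) : R)) using 2; ring
    · convert hup ((β - 1) * ((t⁻¹ : Rˣ) : R)) using 2; ring
  intro g hg
  rcases hunit g hg with h | h
  · exact key g hg h
  · have hup' : upperSL M ∈ principalSL M := by rw [mem_principalSL]; simp
    exact (H.mul_mem_cancel_left hM).1 (key _ (mul_mem hup' hg) h)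

end Elementary

/-! ### Representations with no fixed vectors for the minimal congruence subgroups -/

section ZMod

variable {N : ℕ} [NeZero N]

theorem ZMod.isUnit_or_dvd_of_dvd_sub_one {q : ℕ} (hq : q.Prime) (hqN : q ∣ N) {x : ZMod N}
    (hx : ((N / q : ℕ) : ZMod N) ∣ x - 1) : IsUnit x ∨ (q : ZMod N) ∣ x := by
  by_cases hu : IsUnit x
  · exact Or.inl hu
  right
  have hxv : ((x.val : ℕ) : ZMod N) = x := ZMod.natCast_zmod_val x
  rw [← hxv, ZMod.isUnit_iff_coprime, Nat.Prime.not_coprime_iff_dvd] at hu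
  obtain ⟨r, hr, hrx, hrN⟩ := hu
  have hrq : r = q := by
    by_contra hne
    have hrM : r ∣ N / q := by
      have h1 : r ∣ q * (N / q) := by rwa [Nat.mul_div_cancel' hqN]
      rcases (Nat.Prime.dvd_mul hr).1 h1 with h | h
      · exact absurd ((Nat.prime_dvd_prime_iff_eq hr hq).1 h) hne
      · exact h
    have h2 : (r : ZMod N) ∣ x - 1 := (Nat.cast_dvd_cast hrM).trans hx
    have h3 : (r : ZMod N) ∣ x := by
      have := Nat.cast_dvd_cast (α := ZMod N) hrx
      rwa [hxv] at this
    have h4 : (r : ZMod N) ∣ 1 := by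
      have := dvd_sub h3 h2
      rwa [sub_sub_cancel] at this
    have h5 := (ZMod.isUnit_iff_coprime r N).1 (isUnit_of_dvd_one h4)
    exact (Nat.Prime.not_coprime_iff_dvd.2 ⟨r, hr, dvd_rfl, hrN⟩) h5
  have := Nat.cast_dvd_cast (α := ZMod N) hrx
  rwa [hxv, hrq] at this

theorem ZMod.isUnit_corner_of_mem_principalSL {q : ℕ} (hq : q.Prime) (hqN : q ∣ N)
    {g : SpecialLinearGroup (Fin 2) (ZMod N)} (hg : g ∈ principalSL ((N / q : ℕ) : ZMod N)) :
    IsUnit (g 0 0) ∨ IsUnit ((upperSL ((N / q : ℕ) : ZMod N) * g) 0 0) := by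
  set M := ((N / q : ℕ) : ZMod N)
  have hup' : upperSL M ∈ principalSL M := by rw [mem_principalSL]; simp
  rcases ZMod.isUnit_or_dvd_of_dvd_sub_one hq hqN (mem_principalSL.1 hg).1 with h1 | h1
  · exact Or.inl h1
  rcases ZMod.isUnit_or_dvd_of_dvd_sub_one hq hqN
    (mem_principalSL.1 (mul_mem hup' hg)).1 with h2 | h2
  · exact Or.inr h2
  exfalso
  obtain ⟨-, ⟨β, h3⟩, -, -⟩ := mem_principalSL.1 hg
  have h4 : (q : ZMod N) ∣ M * g 1 0 := by
    have := dvd_sub h2 h1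
    simpa [sl2_mul_apply] using this
  have h5 : (q : ZMod N) ∣ 1 := by
    have h6 : (q : ZMod N) ∣ g 0 0 * g 1 1 - β * (M * g 1 0) :=
      dvd_sub (h1.mul_right _) (h4.mul_left _)
    have h7 := sl2_det' g
    rw [h3] at h7
    rwa [show g 0 0 * g 1 1 - β * (M * g 1 0) = 1 by linear_combination h7] at h6
  have h6 := (ZMod.isUnit_iff_coprime q N).1 (isUnit_of_dvd_one h5)
  exact (Nat.Prime.not_coprime_iff_dvd.2 ⟨q, hq, dvd_rfl, hqN⟩) h6

theorem ZMod.exists_idempotent_of_prime {q : ℕ} (hq : q.Prime) (hqN : q ∣ N) :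
    ∃ e : ZMod N, e * e = e ∧ e * (N / q : ℕ) = (N / q : ℕ) ∧
      ∀ p : ℕ, p.Prime → p ∣ N → p ≠ q → ((N / p : ℕ) : ZMod N) * e = 0 := by
  obtain ⟨a, m, hqm, hN⟩ := Nat.exists_eq_pow_mul_and_not_dvd (NeZero.ne N) q hq.ne_one
  have hcop : Nat.Coprime (q ^ a) m := Nat.Coprime.pow_left _ ((Nat.Prime.coprime_iff_not_dvd hq).2 hqm)
  obtain ⟨k, hk1, hk0⟩ := Nat.chineseRemainder hcop 1 0
  have hmk : (m : ℤ) ∣ k := by exact_mod_cast (Nat.modEq_zero_iff_dvd.1 hk0)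
  have hqk : ((q ^ a : ℕ) : ℤ) ∣ (k : ℤ) - 1 := by
    have := (Nat.modEq_iff_dvd.1 hk1.symm)
    exact_mod_cast this
  have hzero : ∀ z : ℤ, ((q ^ a : ℕ) : ℤ) ∣ z → (m : ℤ) ∣ z → (z : ZMod N) = 0 := by
    intro z h1 h2
    rw [ZMod.intCast_zmod_eq_zero_iff_dvd, hN]
    push_cast at h1 ⊢
    exact IsCoprime.mul_dvd (by exact_mod_cast hcop) h1 h2
  have hqa : q ∣ q ^ a := by
    by_contra h
    rcases (Nat.Prime.dvd_mul hq).1 (hN ▸ hqN) with h' | h' <;> contradiction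
  have hNq : N / q = q ^ a / q * m := by
    rw [hN, Nat.mul_comm, Nat.mul_div_assoc _ hqa, Nat.mul_comm]
  refine ⟨k, ?_, ?_, ?_⟩
  · have := hzero ((k : ℤ) * ((k : ℤ) - 1)) (hqk.mul_left _) (hmk.mul_right _)
    push_cast at this
    linear_combination this
  · have := hzero (((k : ℤ) - 1) * (N / q : ℕ)) (hqk.mul_right _)
      (by rw [hNq]; exact Dvd.dvd.mul_left (by exact_mod_cast dvd_mul_left _ _) _)
    rw [Int.cast_mul, Int.cast_sub, Int.cast_natCast, Int.cast_natCast, Int.cast_one] at this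
    linear_combination this
  · intro p hp hpN hpq
    have := hzero ((N / p : ℕ) * (k : ℤ)) ?_ (hmk.mul_left _)
    · rwa [Int.cast_mul, Int.cast_natCast, Int.cast_natCast] at this
    · refine Dvd.dvd.mul_right ?_ _
      have h1 : q ^ a ∣ p * (N / p) := by
        rw [Nat.mul_div_cancel' hpN, hN]; exact dvd_mul_right _ _
      have h2 : Nat.Coprime (q ^ a) p :=
        Nat.Coprime.pow_left _ ((Nat.coprime_primes hq hp).2 (Ne.symm hpq))
      exact_mod_cast h2.dvd_of_dvd_mul_left h1

end ZMod

section Representation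

variable {N : ℕ} {V : Type*} [AddCommGroup V] [Module ℂ V]
  (ρ : Representation ℂ (SpecialLinearGroup (Fin 2) (ZMod N)) V)

/-- The sum over the subgroup of order `p` of the unipotent group. -/
noncomputable def unipotentSum (p : ℕ) : Module.End ℂ V :=
  ∑ j ∈ Finset.range p, ρ (upperSL ((j : ZMod N) * (N / p : ℕ)))

theorem rho_commute {g h : SpecialLinearGroup (Fin 2) (ZMod N)} (hgh : g * h = h * g) (v : V) :
    ρ g (ρ h v) = ρ h (ρ g v) := by
  rw [← Module.End.mul_apply, ← map_mul, hgh, map_mul, Module.End.mul_apply]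

theorem unipotentSum_apply (p : ℕ) (v : V) :
    unipotentSum ρ p v = ∑ j ∈ Finset.range p, ρ (upperSL ((j : ZMod N) * (N / p : ℕ))) v := by
  simp [unipotentSum]

theorem unipotentSum_commute {p : ℕ} {g : SpecialLinearGroup (Fin 2) (ZMod N)}
    (hg : ∀ j : ZMod N, g * upperSL (j * (N / p : ℕ)) = upperSL (j * (N / p : ℕ)) * g) (v : V) :
    unipotentSum ρ p (ρ g v) = ρ g (unipotentSum ρ p v) := by
  rw [unipotentSum_apply, unipotentSum_apply, map_sum]
  exact Finset.sum_congr rfl fun j _ => (rho_commute ρ (hg _) v).symm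

theorem unipotentSum_commute_unipotentSum (p q : ℕ) (v : V) :
    unipotentSum ρ p (unipotentSum ρ q v) = unipotentSum ρ q (unipotentSum ρ p v) := by
  rw [unipotentSum_apply ρ q, map_sum, unipotentSum_apply ρ q]
  refine Finset.sum_congr rfl fun j _ => unipotentSum_commute ρ (fun i => ?_) v
  rw [upperSL_mul, upperSL_mul, add_comm]

theorem upperSL_unipotentSum {p : ℕ} (hp : p ≠ 0) (hpN : p ∣ N) (v : V) :
    ρ (upperSL ((N / p : ℕ) : ZMod N)) (unipotentSum ρ p v) = unipotentSum ρ p v := by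
  obtain ⟨k, rfl⟩ := Nat.exists_eq_succ_of_ne_zero hp
  rw [unipotentSum_apply, map_sum, Finset.sum_range_succ, Finset.sum_range_succ']
  congr 1
  · refine Finset.sum_congr rfl fun j _ => ?_
    rw [← Module.End.mul_apply, ← map_mul, upperSL_mul]
    congr 3
    push_cast; ring
  · rw [← Module.End.mul_apply, ← map_mul, upperSL_mul]
    congr 3
    have : (((k + 1) * (N / (k + 1)) : ℕ) : ZMod N) = 0 := by
      rw [Nat.mul_div_cancel' hpN, ZMod.natCast_self]
    push_cast at this ⊢
    linear_combination this

theorem unipotentSum_of_fixed {p : ℕ} {v : V} (h : ρ (upperSL ((N / p : ℕ) : ZMod N)) v = v) :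
    unipotentSum ρ p v = (p : ℂ) • v := by
  have : ∀ j : ℕ, ρ (upperSL ((j : ZMod N) * (N / p : ℕ))) v = v := by
    intro j
    rw [← upperSL_pow]
    induction j with
    | zero => simp
    | succ j ih => rw [pow_succ, map_mul, Module.End.mul_apply, h, ih]
  rw [unipotentSum_apply, Finset.sum_congr rfl fun j _ => this j]
  simp [Nat.cast_smul_eq_nsmul]

/-- The common kernel of the unipotent sums for the primes in a set. -/
noncomputable def unipotentKer (S : Finset ℕ) : Submodule ℂ V :=
  ⨅ p ∈ S, LinearMap.ker (unipotentSum ρ p)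

theorem mem_unipotentKer {S : Finset ℕ} {v : V} :
    v ∈ unipotentKer ρ S ↔ ∀ p ∈ S, unipotentSum ρ p v = 0 := by
  simp [unipotentKer, Submodule.mem_iInf]

theorem unipotentKer_ne_bot [NeZero N] [Nontrivial V]
    (hnew : ∀ p : ℕ, p.Prime → p ∣ N → ∀ v : V,
      (∀ g ∈ principalSL ((N / p : ℕ) : ZMod N), ρ g v = v) → v = 0)
    (S : Finset ℕ) (hS : ∀ p ∈ S, p.Prime ∧ p ∣ N) : unipotentKer ρ S ≠ ⊥ := by
  induction S using Finset.induction_on with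
  | empty => simp [unipotentKer]
  | insert q S hqS ih =>
    intro hbot
    have hS' : ∀ p ∈ S, p.Prime ∧ p ∣ N := fun p hp => hS p (Finset.mem_insert_of_mem hp)
    obtain ⟨hq, hqN⟩ := hS q (Finset.mem_insert_self _ _)
    have hfix : ∀ v ∈ unipotentKer ρ S, ρ (upperSL ((N / q : ℕ) : ZMod N)) v = v := by
      intro v hv
      rw [mem_unipotentKer] at hv
      have hw : unipotentSum ρ q v - (q : ℂ) • v ∈ unipotentKer ρ (insert q S) := by
        rw [mem_unipotentKer]
        intro p hp
        rw [map_sub, map_smul]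
        rcases Finset.mem_insert.1 hp with rfl | hp
        · rw [unipotentSum_of_fixed ρ (upperSL_unipotentSum ρ hq.ne_zero hqN v), sub_self]
        · rw [unipotentSum_commute_unipotentSum, hv p hp, map_zero, smul_zero, sub_zero]
      rw [hbot, Submodule.mem_bot, sub_eq_zero] at hw
      have h := upperSL_unipotentSum ρ hq.ne_zero hqN v
      rw [hw, map_smul] at h
      exact smul_right_injective V (by exact_mod_cast hq.ne_zero : (q : ℂ) ≠ 0) h
    obtain ⟨e, hee, heM, he0⟩ := ZMod.exists_idempotent_of_prime hq hqN
    have hinv : ∀ k ∈ principalSL e, ∀ v ∈ unipotentKer ρ S, ρ k v ∈ unipotentKer ρ S := by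
      intro k hk v hv
      rw [mem_unipotentKer] at hv ⊢
      intro p hp
      rw [unipotentSum_commute, hv p hp, map_zero]
      intro j
      have h0 := he0 p (hS' p hp).1 (hS' p hp).2 (fun h => hqS (h ▸ hp))
      obtain ⟨⟨α, h1⟩, ⟨β, h2⟩, ⟨γ, h3⟩, ⟨δ, h4⟩⟩ := mem_principalSL.1 hk
      rw [sub_eq_iff_eq_add] at h1 h4
      apply sl2_ext <;> simp only [sl2_mul_apply, h1, h2, h3, h4, upperSL_apply_00,
        upperSL_apply_01, upperSL_apply_10, upperSL_apply_11]
      · linear_combination (-j * γ) * h0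
      · linear_combination (j * α - j * δ) * h0
      · ring
      · linear_combination (j * γ) * h0
    let H : Subgroup (SpecialLinearGroup (Fin 2) (ZMod N)) :=
      { carrier := {g | ∀ v ∈ unipotentKer ρ S, ρ g v = v}
        mul_mem' := fun {a b} ha hb v hv => by
          rw [map_mul, Module.End.mul_apply, hb v hv, ha v hv]
        one_mem' := fun v _ => by simp
        inv_mem' := fun {a} ha v hv => by
          conv_lhs => rw [← ha v hv]
          rw [← Module.End.mul_apply, ← map_mul, inv_mul_cancel, map_one, Module.End.one_apply] }
    have hle : principalSL ((N / q : ℕ) : ZMod N) ≤ H := by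
      refine principalSL_le_of_upperSL_mem hee heM (fun x => ⟨x.val, (ZMod.natCast_zmod_val x).symm⟩)
        (fun g hg => ZMod.isUnit_corner_of_mem_principalSL hq hqN hg) ?_ hfix
      intro k hk h hh v hv
      rw [map_mul, map_mul, Module.End.mul_apply, Module.End.mul_apply,
        hh _ (hinv _ (inv_mem hk) v hv), ← Module.End.mul_apply, ← map_mul, mul_inv_cancel,
        map_one, Module.End.one_apply]
    refine ih hS' ((Submodule.eq_bot_iff _).2 fun v hv => ?_)
    exact hnew q hq hqN v fun g hg => hle hg v hv

theorem card_squares_le_finrank [NeZero N] [Nontrivial V] [FiniteDimensional ℂ V]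
    (hnew : ∀ p : ℕ, p.Prime → p ∣ N → ∀ v : V,
      (∀ g ∈ principalSL ((N / p : ℕ) : ZMod N), ρ g v = v) → v = 0) :
    (Finset.univ.image fun t : (ZMod N)ˣ => t ^ 2).card ≤ Module.finrank ℂ V := by
  classical
  set W := unipotentKer ρ N.primeFactors with hW
  have hWne : W ≠ ⊥ := unipotentKer_ne_bot ρ hnew _ fun p hp =>
    ⟨Nat.prime_of_mem_primeFactors hp, Nat.dvd_of_mem_primeFactors hp⟩
  have hWinv : ∀ v ∈ W, ρ (upperSL 1) v ∈ W := by
    intro v hv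
    rw [hW, mem_unipotentKer] at hv ⊢
    intro p hp
    rw [unipotentSum_commute, hv p hp, map_zero]
    intro j
    rw [upperSL_mul, upperSL_mul, add_comm]
  have : Nontrivial W := (Submodule.nontrivial_iff_ne_bot).2 hWne
  obtain ⟨ζ, hζ⟩ := Module.End.exists_eigenvalue ((ρ (upperSL 1)).restrict hWinv)
  obtain ⟨⟨v, hvW⟩, hv⟩ := hζ.exists_hasEigenvector
  have hv0 : v ≠ 0 := fun h => hv.2 (Subtype.ext h)
  have hv1 : ρ (upperSL 1) v = ζ • v := congrArg Subtype.val hv.apply_eq_smul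
  have hpow : ∀ n : ℕ, ρ (upperSL (n : ZMod N)) v = ζ ^ n • v := by
    intro n
    induction n with
    | zero => simp [upperSL_zero]
    | succ n ih =>
      rw [Nat.cast_succ, ← upperSL_mul, map_mul, Module.End.mul_apply, hv1, map_smul, ih,
        smul_smul, pow_succ']
  have hord : orderOf ζ = N := by
    refine orderOf_eq_of_pow_and_pow_div_prime (NeZero.pos N) ?_ ?_
    · have h := hpow N
      rw [ZMod.natCast_self, upperSL_zero, map_one, Module.End.one_apply] at h
      exact (smul_left_injective ℂ hv0 ((one_smul ℂ v).trans h)).symm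
    · intro p hp hpN h1
      have h := hpow (N / p)
      rw [h1, one_smul] at h
      have h2 := unipotentSum_of_fixed ρ h
      rw [(mem_unipotentKer ρ).1 hvW p (Nat.mem_primeFactors.2 ⟨hp, hpN, NeZero.ne N⟩)] at h2
      rcases smul_eq_zero.1 h2.symm with h3 | h3
      · exact hp.ne_zero (by exact_mod_cast h3)
      · exact hv0 h3
  set Q := Finset.univ.image fun t : (ZMod N)ˣ => t ^ 2
  have hroot : ∀ s : Q, ∃ t : (ZMod N)ˣ, t ^ 2 = s.1 := fun s => by
    obtain ⟨t, -, ht⟩ := Finset.mem_image.1 s.2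
    exact ⟨t, ht⟩
  choose r hr using hroot
  have hli := Module.End.eigenvectors_linearIndependent' (ρ (upperSL 1))
    (fun s : Q => ζ ^ (s.1 : ZMod N).val) ?_ (fun s : Q => ρ (diagSL (r s)) v) ?_
  · simpa using hli.fintype_card_le_finrank
  · intro s s' h
    have h' := pow_injOn_Iio_orderOf (x := ζ) (by simpa [hord] using ZMod.val_lt _)
      (by simpa [hord] using ZMod.val_lt _) h
    exact Subtype.ext (Units.ext (ZMod.val_injective N h'))
  · intro s
    rw [Module.End.hasEigenvector_iff, Module.End.mem_eigenspace_iff]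
    refine ⟨?_, fun h => hv0 ?_⟩
    · rw [← Module.End.mul_apply, ← map_mul, upperSL_mul_diagSL, map_mul, Module.End.mul_apply,
        mul_one]
      have h := hpow (s.1 : ZMod N).val
      rw [ZMod.natCast_zmod_val, ← hr s, Units.val_pow_eq_pow_val] at h
      rw [h, map_smul, ← hr s, Units.val_pow_eq_pow_val]
    · have h2 := congrArg (ρ (diagSL (r s))⁻¹) h
      rwa [← Module.End.mul_apply, ← map_mul, inv_mul_cancel, map_one, Module.End.one_apply,
        map_zero] at h2

end Representation

/-! ### Reduction modulo `N` -/

/-- Reduction of `SL₂(ℤ)` modulo `N`. -/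
def redSL (N : ℕ) : SpecialLinearGroup (Fin 2) ℤ →* SpecialLinearGroup (Fin 2) (ZMod N) :=
  SpecialLinearGroup.map (Int.castRingHom (ZMod N))

theorem redSL_apply (N : ℕ) (g : SpecialLinearGroup (Fin 2) ℤ) (i j : Fin 2) :
    redSL N g i j = (g i j : ZMod N) := rfl

theorem redSL_upperSL (N : ℕ) (b : ℤ) : redSL N (upperSL b) = upperSL (b : ZMod N) := by
  apply sl2_ext <;> simp [redSL_apply]

theorem redSL_lowerSL (N : ℕ) (b : ℤ) : redSL N (lowerSL b) = lowerSL (b : ZMod N) := by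
  apply sl2_ext <;> simp [redSL_apply]

theorem sl2_inv_entries {R : Type*} [CommRing R] (g : SpecialLinearGroup (Fin 2) R) :
    g⁻¹ 0 0 = g 1 1 ∧ g⁻¹ 0 1 = -g 0 1 ∧ g⁻¹ 1 0 = -g 1 0 ∧ g⁻¹ 1 1 = g 0 0 := by
  rw [SpecialLinearGroup.SL2_inv_expl]
  exact ⟨rfl, rfl, rfl, rfl⟩

theorem ZMod.exists_isUnit_add_mul {N : ℕ} [NeZero N] {a c : ZMod N} (h : IsCoprime a c) :
    ∃ x : ZMod N, IsUnit (a + x * c) := by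
  refine ⟨((∏ p ∈ N.primeFactors.filter (fun p => ¬p ∣ a.val), p : ℕ) : ZMod N), ?_⟩
  set x := ∏ p ∈ N.primeFactors.filter (fun p => ¬p ∣ a.val), p with hx
  have e : a + (x : ZMod N) * c = ((a.val + x * c.val : ℕ) : ZMod N) := by
    push_cast
    rw [ZMod.natCast_zmod_val, ZMod.natCast_zmod_val]
  rw [e, ZMod.isUnit_iff_coprime]
  by_contra hnc
  obtain ⟨p, hp, hpx, hpN⟩ := Nat.Prime.not_coprime_iff_dvd.1 hnc
  have hpmem : p ∈ N.primeFactors := Nat.mem_primeFactors.2 ⟨hp, hpN, NeZero.ne N⟩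
  by_cases hpa : p ∣ a.val
  · have h1 : p ∣ x * c.val := (Nat.dvd_add_right hpa).1 hpx
    have h2 : ¬p ∣ x := by
      intro h2
      rw [hx, hp.prime.dvd_finsetProd_iff] at h2
      obtain ⟨q, hq, hpq⟩ := h2
      rw [Finset.mem_filter] at hq
      rw [(Nat.prime_dvd_prime_iff_eq hp (Nat.prime_of_mem_primeFactors hq.1)).1 hpq] at hpa
      exact hq.2 hpa
    have h3 : p ∣ c.val := (hp.dvd_mul.1 h1).resolve_left h2
    obtain ⟨u, v, huv⟩ := h
    have h4 : (p : ZMod N) ∣ 1 := by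
      have ha := Nat.cast_dvd_cast (α := ZMod N) hpa
      have hc := Nat.cast_dvd_cast (α := ZMod N) h3
      rw [ZMod.natCast_zmod_val] at ha hc
      rw [← huv]
      exact dvd_add (ha.mul_left _) (hc.mul_left _)
    have h5 := (ZMod.isUnit_iff_coprime p N).1 (isUnit_of_dvd_one h4)
    exact (Nat.Prime.not_coprime_iff_dvd.2 ⟨p, hp, dvd_rfl, hpN⟩) h5
  · have h1 : p ∣ x := Finset.dvd_prod_of_mem _ (Finset.mem_filter.2 ⟨hpmem, hpa⟩)
    exact hpa ((Nat.dvd_add_left (h1.mul_right _)).1 hpx)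

theorem redSL_surjective (N : ℕ) [NeZero N] : Function.Surjective (redSL N) := by
  have hup : ∀ x : ZMod N, upperSL x ∈ (redSL N).range := fun x =>
    ⟨upperSL (x.val : ℤ), by rw [redSL_upperSL, Int.cast_natCast, ZMod.natCast_zmod_val]⟩
  have hlow : ∀ x : ZMod N, lowerSL x ∈ (redSL N).range := fun x =>
    ⟨lowerSL (x.val : ℤ), by rw [redSL_lowerSL, Int.cast_natCast, ZMod.natCast_zmod_val]⟩
  have key : ∀ g : SpecialLinearGroup (Fin 2) (ZMod N), IsUnit (g 0 0) → g ∈ (redSL N).range := by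
    rintro g ⟨t, ht⟩
    have hc : (upperSL ((t : ZMod N) - 1) * lowerSL (1 : ZMod N)) 0 0 = t := by
      simp [sl2_mul_apply]
    rw [eq_lowerSL_mul_mul_upperSL ht.symm hc]
    exact mul_mem (mul_mem (hlow _) (mul_mem (hup _) (hlow _))) (hup _)
  intro g
  obtain ⟨x, hx⟩ := ZMod.exists_isUnit_add_mul
    (show IsCoprime (g 0 0) (g 1 0) from ⟨g 1 1, -g 0 1, by linear_combination sl2_det' g⟩)
  have h := key (upperSL x * g) (by simpa [sl2_mul_apply] using hx)
  exact ((redSL N).range.mul_mem_cancel_left (hup x)).1 h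

theorem redSL_eq_one_iff {N : ℕ} {g : SpecialLinearGroup (Fin 2) ℤ} :
    redSL N g = 1 ↔ g ∈ CongruenceSubgroup.Gamma N := Iff.rfl

theorem card_sl2_zmod_le (N : ℕ) [NeZero N] :
    Fintype.card (SpecialLinearGroup (Fin 2) (ZMod N)) ≤ N ^ 3 := by
  classical
  have h := Finset.card_le_mul_card_image (s := Finset.univ)
    (f := fun g : SpecialLinearGroup (Fin 2) (ZMod N) => (g 0 0, g 0 1)) N ?_
  · rw [Finset.card_univ] at h
    refine h.trans ?_
    have h2 := Finset.card_le_univ (Finset.univ.image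
      (fun g : SpecialLinearGroup (Fin 2) (ZMod N) => (g 0 0, g 0 1)))
    rw [Fintype.card_prod, ZMod.card] at h2
    calc _ ≤ N * (N * N) := Nat.mul_le_mul_left _ h2
      _ = N ^ 3 := by ring
  · intro b hb
    obtain ⟨g₀, -, rfl⟩ := Finset.mem_image.1 hb
    calc _ ≤ (Finset.univ : Finset (ZMod N)).card := by
          refine Finset.card_le_card_of_injOn (fun g => (g * g₀⁻¹) 1 0) (by simp) ?_
          intro g hg g' hg' hgg
          simp only [Finset.coe_filter, Finset.mem_univ, true_and, Set.mem_ofPred_eq,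
            Prod.mk.injEq] at hg hg'
          have hrow : ∀ k : SpecialLinearGroup (Fin 2) (ZMod N), k 0 0 = g₀ 0 0 ∧ k 0 1 = g₀ 0 1 →
              k * g₀⁻¹ = lowerSL ((k * g₀⁻¹) 1 0) := by
            rintro k ⟨h1, h2⟩
            have d1 := sl2_det' k
            have d2 := sl2_det' g₀
            rw [h1, h2] at d1
            obtain ⟨i1, i2, i3, i4⟩ := sl2_inv_entries g₀
            apply sl2_ext <;> simp [sl2_mul_apply, i1, i2, i3, i4, h1, h2]
            · linear_combination d2
            · ring
            · linear_combination d1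
          refine mul_right_cancel (b := g₀⁻¹) ?_
          rw [hrow g hg, hrow g' hg']
          exact congrArg lowerSL hgg
      _ = N := by rw [Finset.card_univ, ZMod.card]

theorem eq_top_of_upperSL_mem_of_lowerSL_mem {H : Subgroup (SpecialLinearGroup (Fin 2) ℤ)}
    (h1 : upperSL 1 ∈ H) (h2 : lowerSL 1 ∈ H) : H = ⊤ := by
  rw [eq_top_iff, ← SpecialLinearGroup.SL2Z_generators, Subgroup.closure_le]
  have hS : ModularGroup.S = (upperSL 1)⁻¹ * lowerSL 1 * (upperSL (1 : ℤ))⁻¹ := by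
    have : (upperSL (1 : ℤ))⁻¹ = upperSL (-1) := by
      rw [inv_eq_iff_mul_eq_one, upperSL_mul, ← upperSL_zero]; norm_num
    rw [this]
    apply sl2_ext <;> simp [sl2_mul_apply, ModularGroup.S]
  have hT : ModularGroup.T = upperSL (1 : ℤ) := rfl
  rintro g (rfl | rfl)
  · rw [hS]
    exact mul_mem (mul_mem (inv_mem h1) h2) (inv_mem h1)
  · exact h1

theorem upperSL_mul_lowerSL_mem_cell {R : ℕ} {a : ℤ} (h1 : (R : ℤ) < 2 * a) (h2 : a ≤ R)
    (h3 : 2 ≤ a) : upperSL (a - 1) * lowerSL 1 ∈ cell R := by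
  rw [mem_cell]
  simp only [sl2_mul_apply, upperSL_apply_00, upperSL_apply_01, upperSL_apply_10,
    upperSL_apply_11, lowerSL_apply_00, lowerSL_apply_01, lowerSL_apply_10, lowerSL_apply_11]
  omega

theorem closure_block_eq_top {R : ℕ} (hR : 3 ≤ R) :
    Subgroup.closure (block R : Set (SpecialLinearGroup (Fin 2) ℤ)) = ⊤ := by
  set H := Subgroup.closure (block R : Set (SpecialLinearGroup (Fin 2) ℤ))
  have hmem : ∀ a : ℤ, (R : ℤ) < 2 * a → a ≤ R → 2 ≤ a → upperSL (a - 1) * lowerSL 1 ∈ H :=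
    fun a h1 h2 h3 => Subgroup.subset_closure
      (mem_block.2 (Or.inl (upperSL_mul_lowerSL_mem_cell h1 h2 h3)))
  have h1 := hmem R (by omega) le_rfl (by omega)
  have h2 := hmem (R - 1) (by omega) (by omega) (by omega)
  have hA : upperSL 1 ∈ H := by
    have h := mul_mem h1 (inv_mem h2)
    rw [_root_.mul_inv_rev, mul_assoc, mul_inv_cancel_left, ← div_eq_mul_inv] at h
    have e : upperSL ((R : ℤ) - 1) / upperSL ((R : ℤ) - 1 - 1) = upperSL 1 := by
      rw [div_eq_iff_eq_mul, upperSL_mul]; ring_nf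
    rwa [e] at h
  have hAn : upperSL ((R : ℤ) - 1) ∈ H := by
    have e : upperSL ((R : ℤ) - 1) = upperSL 1 ^ (R - 1) := by
      rw [upperSL_pow, Nat.cast_sub (by omega)]; simp
    rw [e]
    exact H.pow_mem hA _
  exact eq_top_of_upperSL_mem_of_lowerSL_mem hA ((H.mul_mem_cancel_left hAn).1 h1)

/-! ### The averaging operator on `SL₂(ℤ/Nℤ)` -/

section Operator

variable (R N : ℕ)

/-- The sum of the right translations by the elements of `block R`, acting on functions
on `SL₂(ℤ/Nℤ)`. -/
noncomputable def blockOp : Module.End ℂ (EuclideanSpace ℂ (SpecialLinearGroup (Fin 2) (ZMod N))) where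
  toFun f := WithLp.toLp 2 fun x => ∑ h ∈ block R, f (x * redSL N h)
  map_add' f g := by ext x; simp [Finset.sum_add_distrib]
  map_smul' c f := by ext x; simp [Finset.mul_sum]

variable {N}

theorem blockOp_apply (f : EuclideanSpace ℂ (SpecialLinearGroup (Fin 2) (ZMod N)))
    (x : SpecialLinearGroup (Fin 2) (ZMod N)) :
    blockOp R N f x = ∑ h ∈ block R, f (x * redSL N h) := rfl

theorem blockOp_pow_apply (k : ℕ) (f : EuclideanSpace ℂ (SpecialLinearGroup (Fin 2) (ZMod N)))
    (x : SpecialLinearGroup (Fin 2) (ZMod N)) :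
    (blockOp R N ^ k) f x =
      ∑ g ∈ slBall ((2 * R) ^ k), wordCount R k g • f (x * redSL N g) := by
  induction k generalizing x with
  | zero =>
    rw [Finset.sum_eq_single 1]
    · simp [wordCount]
    · intro g _ hg
      rw [wordCount, Set.indicator_of_notMem (by simpa using hg), zero_smul]
    · intro h
      exact absurd (mem_slBall.2 fun i j => by fin_cases i <;> fin_cases j <;> simp) h
  | succ k ih =>
    rw [pow_succ', Module.End.mul_apply, blockOp_apply, sum_wordCount_succ]
    refine Finset.sum_congr rfl fun h _ => ?_
    simp only [ih, map_mul, mul_assoc]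

variable [NeZero N]

theorem blockOp_isSymmetric : (blockOp R N).IsSymmetric := by
  intro f g
  simp only [PiLp.inner_apply, blockOp_apply, sum_inner, inner_sum]
  rw [Finset.sum_comm, Finset.sum_comm (s := Finset.univ)]
  refine Finset.sum_nbij' (fun h => h⁻¹) (fun h => h⁻¹) (fun h hh => inv_mem_block hh)
    (fun h hh => inv_mem_block hh) (fun h _ => inv_inv h) (fun h _ => inv_inv h) fun h _ => ?_
  refine Fintype.sum_equiv (Equiv.mulRight (redSL N h)) _ _ fun x => ?_
  simp [mul_assoc]

/-- The energy of a function along the block. -/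
theorem sum_norm_sub_sq_eq (f : EuclideanSpace ℂ (SpecialLinearGroup (Fin 2) (ZMod N))) :
    ∑ x, ∑ h ∈ block R, ‖f (x * redSL N h) - f x‖ ^ 2 =
      2 * ((block R).card * ‖f‖ ^ 2 - (inner ℂ (blockOp R N f) f).re) := by
  have h1 : ∀ x, ∑ h ∈ block R, ‖f (x * redSL N h) - f x‖ ^ 2 =
      ∑ h ∈ block R, ‖f (x * redSL N h)‖ ^ 2 - 2 * (inner ℂ (blockOp R N f x) (f x)).re +
        (block R).card * ‖f x‖ ^ 2 := by
    intro x
    rw [blockOp_apply, sum_inner, Complex.re_sum, Finset.mul_sum]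
    rw [← nsmul_eq_mul, ← Finset.sum_const, ← Finset.sum_sub_distrib, ← Finset.sum_add_distrib]
    exact Finset.sum_congr rfl fun h _ => norm_sub_sq (𝕜 := ℂ) _ _
  have h2 : ∑ x, ∑ h ∈ block R, ‖f (x * redSL N h)‖ ^ 2 = (block R).card * ‖f‖ ^ 2 := by
    rw [Finset.sum_comm, EuclideanSpace.norm_sq_eq, ← nsmul_eq_mul, ← Finset.sum_const]
    exact Finset.sum_congr rfl fun h _ =>
      Fintype.sum_equiv (Equiv.mulRight (redSL N h)) _ _ fun x => rfl
  have h3 : ∑ x, (inner ℂ (blockOp R N f x) (f x)).re = (inner ℂ (blockOp R N f) f).re := by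
    rw [PiLp.inner_apply, Complex.re_sum]
  simp only [h1]
  rw [Finset.sum_add_distrib, Finset.sum_sub_distrib, h2, ← Finset.mul_sum, ← Finset.mul_sum, h3,
    ← EuclideanSpace.norm_sq_eq]
  ring

theorem norm_blockOp_pow_single_sq (k : ℕ) (x : SpecialLinearGroup (Fin 2) (ZMod N)) :
    ‖(blockOp R N ^ k) (EuclideanSpace.single x 1)‖ ^ 2 =
      ∑ g ∈ gammaBall N ((2 * R) ^ (2 * k)), wordCount R (2 * k) g := by
  classical
  have h1 : ‖(blockOp R N ^ k) (EuclideanSpace.single x 1)‖ ^ 2 =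
      ((blockOp R N ^ (2 * k)) (EuclideanSpace.single x 1) x).re := by
    rw [← inner_self_eq_norm_sq (𝕜 := ℂ), ← (blockOp_isSymmetric R).pow k, two_mul, pow_add,
      Module.End.mul_apply, EuclideanSpace.inner_single_right]
    simp
  rw [h1, blockOp_pow_apply, Complex.re_sum, gammaBall, Finset.sum_filter]
  refine Finset.sum_congr rfl fun g _ => ?_
  have e : x * redSL N g = x ↔ g ∈ CongruenceSubgroup.Gamma N :=
    mul_eq_left.trans redSL_eq_one_iff
  rw [Complex.smul_re, PiLp.single_apply, smul_eq_mul]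
  by_cases hg : g ∈ CongruenceSubgroup.Gamma N
  · rw [if_pos (e.2 hg), if_pos hg]
    simp
  · rw [if_neg (mt e.1 hg), if_neg hg]
    simp

theorem finrank_eigenspace_mul_le (k : ℕ) (μ : ℝ) :
    (Module.finrank ℂ ((blockOp R N).eigenspace (μ : ℂ)) : ℝ) * μ ^ (2 * k) ≤
      (N : ℝ) ^ 3 * ∑ g ∈ gammaBall N ((2 * R) ^ (2 * k)), wordCount R (2 * k) g := by
  set T := blockOp R N
  set W := T.eigenspace (μ : ℂ)
  let b := stdOrthonormalBasis ℂ W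
  have hb : Orthonormal ℂ (fun i => (b i : EuclideanSpace ℂ (SpecialLinearGroup (Fin 2) (ZMod N)))) :=
    b.orthonormal.comp_linearIsometry W.subtypeₗᵢ
  have hTb : ∀ i, (T ^ k) (b i) = (μ : ℂ) ^ k • (b i).1 := by
    intro i
    have : T (b i) = (μ : ℂ) • (b i).1 := Module.End.mem_eigenspace_iff.1 (b i).2
    clear_value T
    induction k with
    | zero => simp
    | succ k ih => rw [pow_succ', Module.End.mul_apply, ih, map_smul, this, smul_smul, pow_succ]
  have h1 : ∀ x, ∑ i, ‖inner ℂ (b i).1 ((T ^ k) (EuclideanSpace.single x 1))‖ ^ 2 ≤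
      ∑ g ∈ gammaBall N ((2 * R) ^ (2 * k)), wordCount R (2 * k) g := by
    intro x
    rw [← norm_blockOp_pow_single_sq R k x]
    exact hb.sum_inner_products_le _
  have h2 : ∀ x i, ‖inner ℂ (b i).1 ((T ^ k) (EuclideanSpace.single x 1))‖ ^ 2 =
      μ ^ (2 * k) * ‖(b i).1 x‖ ^ 2 := by
    intro x i
    rw [← (blockOp_isSymmetric R).pow k, hTb, EuclideanSpace.inner_single_right]
    simp [mul_pow]
    left
    rw [← pow_mul, mul_comm k 2, pow_mul, sq_abs, ← pow_mul]
  have h3 : ∀ i, ∑ x, ‖(b i).1 x‖ ^ 2 = 1 := by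
    intro i
    rw [← EuclideanSpace.norm_sq_eq, hb.1 i, one_pow]
  calc (Module.finrank ℂ W : ℝ) * μ ^ (2 * k)
      = ∑ x, ∑ i, ‖inner ℂ (b i).1 ((T ^ k) (EuclideanSpace.single x 1))‖ ^ 2 := by
        rw [Finset.sum_comm]
        simp only [h2, ← Finset.mul_sum, h3]
        simp [mul_comm]
    _ ≤ ∑ _x : SpecialLinearGroup (Fin 2) (ZMod N),
          ∑ g ∈ gammaBall N ((2 * R) ^ (2 * k)), wordCount R (2 * k) g :=
        Finset.sum_le_sum fun x _ => h1 x
    _ ≤ _ := by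
        rw [Finset.sum_const, nsmul_eq_mul, Finset.card_univ]
        refine mul_le_mul_of_nonneg_right ?_ (Finset.sum_nonneg fun g _ => wordCount_nonneg _ _ _)
        exact_mod_cast card_sl2_zmod_le N

end Operator

section Eigenspaces

variable {R N : ℕ}

/-- The representation of `SL₂(ℤ/Nℤ)` by left translations on an eigenspace of `blockOp`. -/
noncomputable def translateRep (R N : ℕ) (μ : ℂ) :
    Representation ℂ (SpecialLinearGroup (Fin 2) (ZMod N)) ((blockOp R N).eigenspace μ) where
  toFun g :=
    { toFun f := ⟨WithLp.toLp 2 fun x => f.1 (g⁻¹ * x), by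
        rw [Module.End.mem_eigenspace_iff]
        ext x
        have := congrArg (fun F => F (g⁻¹ * x)) (Module.End.mem_eigenspace_iff.1 f.2)
        simpa [blockOp, mul_assoc] using this⟩
      map_add' f₁ f₂ := rfl
      map_smul' c f := rfl }
  map_one' := by
    ext f x
    change f.1 (1⁻¹ * x) = f.1 x
    simp
  map_mul' g h := by
    ext f x
    change f.1 ((g * h)⁻¹ * x) = f.1 (h⁻¹ * (g⁻¹ * x))
    rw [_root_.mul_inv_rev, mul_assoc]

theorem translateRep_apply (μ : ℂ) (g : SpecialLinearGroup (Fin 2) (ZMod N))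
    (f : (blockOp R N).eigenspace μ) (x : SpecialLinearGroup (Fin 2) (ZMod N)) :
    (translateRep R N μ g f).1 x = f.1 (g⁻¹ * x) := rfl

theorem redSL_mem_principalSL {M : ℕ} {g : SpecialLinearGroup (Fin 2) ℤ}
    (hg : g ∈ CongruenceSubgroup.Gamma M) : redSL N g ∈ principalSL (M : ZMod N) := by
  have key : ∀ a b : ℤ, (a : ZMod M) = b → (M : ZMod N) ∣ (a : ZMod N) - b := by
    intro a b h
    obtain ⟨c, hc⟩ := (ZMod.intCast_eq_intCast_iff_dvd_sub b a M).1 h.symm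
    exact ⟨c, by rw [← Int.cast_sub, hc]; push_cast; rfl⟩
  obtain ⟨h1, h2, h3, h4⟩ := CongruenceSubgroup.Gamma_mem.1 hg
  rw [mem_principalSL]
  refine ⟨?_, ?_, ?_, ?_⟩
  · simpa [redSL_apply] using key (g 0 0) 1 (by simpa using h1)
  · simpa [redSL_apply] using key (g 0 1) 0 (by simpa using h2)
  · simpa [redSL_apply] using key (g 1 0) 0 (by simpa using h3)
  · simpa [redSL_apply] using key (g 1 1) 1 (by simpa using h4)

/-- An eigenfunction of level `N` that is invariant under the kernel of the reduction
modulo `M` comes from level `M`. -/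
theorem hasEigenvalue_of_translateRep_eq [NeZero N] {M : ℕ} [NeZero M] {μ : ℂ}
    {f : (blockOp R N).eigenspace μ} (hf : f ≠ 0)
    (hfix : ∀ g ∈ principalSL (M : ZMod N), translateRep R N μ g f = f) :
    (blockOp R M).HasEigenvalue μ := by
  have key : ∀ a b, redSL M a = redSL M b → f.1 (redSL N a) = f.1 (redSL N b) := by
    intro a b hab
    have h1 : b * a⁻¹ ∈ CongruenceSubgroup.Gamma M := by
      rw [← redSL_eq_one_iff, map_mul, map_inv, hab, mul_inv_cancel]
    have h2 := hfix _ (redSL_mem_principalSL (N := N) h1)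
    conv_rhs => rw [← h2]
    rw [translateRep_apply]
    simp
  let s := Function.surjInv (redSL_surjective M)
  have hs : ∀ y, redSL M (s y) = y := Function.surjInv_eq _
  let F : EuclideanSpace ℂ (SpecialLinearGroup (Fin 2) (ZMod M)) :=
    WithLp.toLp 2 fun y => f.1 (redSL N (s y))
  have hF : ∀ a, F (redSL M a) = f.1 (redSL N a) := fun a => key _ _ (hs _)
  refine Module.End.hasEigenvalue_of_hasEigenvector (x := F) ⟨?_, ?_⟩
  · rw [Module.End.mem_eigenspace_iff]
    ext y
    obtain ⟨a, rfl⟩ := redSL_surjective M y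
    have := congrArg (fun F => F (redSL N a)) (Module.End.mem_eigenspace_iff.1 f.2)
    simp only [blockOp_apply, ← map_mul, PiLp.smul_apply, hF] at this ⊢
    exact this
  · intro h0
    apply hf
    ext x
    obtain ⟨a, rfl⟩ := redSL_surjective N x
    rw [← hF, h0]
    rfl

theorem le_finrank_or_hasEigenvalue [NeZero N] {μ : ℂ} (hμ : (blockOp R N).HasEigenvalue μ) :
    (Finset.univ.image fun t : (ZMod N)ˣ => t ^ 2).card ≤
        Module.finrank ℂ ((blockOp R N).eigenspace μ) ∨
      ∃ M, 0 < M ∧ M < N ∧ (blockOp R M).HasEigenvalue μ := by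
  by_cases h : ∀ p : ℕ, p.Prime → p ∣ N → ∀ v : (blockOp R N).eigenspace μ,
      (∀ g ∈ principalSL ((N / p : ℕ) : ZMod N), translateRep R N μ g v = v) → v = 0
  · left
    have : Nontrivial ((blockOp R N).eigenspace μ) :=
      Submodule.nontrivial_iff_ne_bot.2 hμ
    exact card_squares_le_finrank _ h
  · right
    push Not at h
    obtain ⟨p, hp, hpN, v, hv, hv0⟩ := h
    have hN := NeZero.pos N
    have hM : 0 < N / p := Nat.div_pos (Nat.le_of_dvd hN hpN) hp.pos
    have : NeZero (N / p) := ⟨hM.ne'⟩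
    exact ⟨N / p, hM, Nat.div_lt_self hN hp.one_lt, hasEigenvalue_of_translateRep_eq hv0 hv⟩

theorem sum_norm_sub_sq_eq_of_apply_eq_smul [NeZero N] {μ : ℝ}
    {f : EuclideanSpace ℂ (SpecialLinearGroup (Fin 2) (ZMod N))}
    (hf : blockOp R N f = (μ : ℂ) • f) :
    ∑ x, ∑ h ∈ block R, ‖f (x * redSL N h) - f x‖ ^ 2 =
      2 * (((block R).card - μ) * ‖f‖ ^ 2) := by
  have h3 : (inner ℂ (blockOp R N f) f).re = μ * ‖f‖ ^ 2 := by
    rw [hf, inner_smul_left, inner_self_eq_norm_sq_to_K]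
    simp [← Complex.ofReal_pow]
  rw [sum_norm_sub_sq_eq, h3]
  ring

theorem le_card_block_of_hasEigenvalue [NeZero N] {μ : ℝ}
    (hμ : (blockOp R N).HasEigenvalue (μ : ℂ)) : μ ≤ (block R).card := by
  obtain ⟨f, hf⟩ := hμ.exists_hasEigenvector
  have h1 : (0 : ℝ) ≤ ∑ x, ∑ h ∈ block R, ‖f (x * redSL N h) - f x‖ ^ 2 := by positivity
  have h2 : 0 < ‖f‖ ^ 2 := by have := norm_pos_iff.2 hf.2; positivity
  rw [sum_norm_sub_sq_eq_of_apply_eq_smul hf.apply_eq_smul] at h1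
  by_contra hc
  nlinarith

end Eigenspaces

/-- A finite set of numbers that are at most `b` has a uniform gap below `b`. -/
theorem exists_gap_of_finite {s : Set ℝ} (hs : s.Finite) {b : ℝ} (hb : 0 < b)
    (h : ∀ x ∈ s, x ≤ b) : ∃ κ : ℝ, 0 < κ ∧ κ ≤ 1 / 2 ∧ ∀ x ∈ s, x ≠ b → x ≤ (1 - κ) * b := by
  induction s, hs using Set.Finite.induction_on with
  | empty => exact ⟨1 / 2, by norm_num, le_rfl, by simp⟩
  | @insert a s ha hs ih =>
    obtain ⟨κ, h0, h1, h2⟩ := ih fun x hx => h x (Set.mem_insert_of_mem _ hx)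
    have ha := h a (Set.mem_insert _ _)
    by_cases hab : a = b
    · refine ⟨κ, h0, h1, ?_⟩
      rintro x (rfl | hx) hxb
      · exact absurd hab hxb
      · exact h2 x hx hxb
    · refine ⟨min κ (1 - a / b), lt_min h0 ?_, (min_le_left _ _).trans h1, ?_⟩
      · rw [sub_pos, div_lt_one hb]
        exact lt_of_le_of_ne ha hab
      · rintro x (rfl | hx) hxb
        · have : (1 - min κ (1 - x / b)) ≥ x / b := by linarith [min_le_right κ (1 - x / b)]
          calc x = x / b * b := by field_simp
            _ ≤ _ := by gcongr
        · refine (h2 x hx hxb).trans ?_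
          gcongr
          exact min_le_left _ _

theorem exists_card_block_mul_rpow_ge :
    ∃ R : ℕ, 3 ≤ R ∧
      2 * (2 * cellBound R) * (2 * R : ℝ) ≤ (block R).card * (2 * R : ℝ) ^ (1 / 10 : ℝ) := by
  obtain ⟨C, hC, h⟩ := exists_card_cell_ge (ε := 1 / 40) (by norm_num)
  have ht : ∀ᶠ R : ℕ in Filter.atTop, 192 * C * 201 ≤ (R : ℝ) ^ (1 / 20 : ℝ) :=
    ((tendsto_rpow_atTop (by norm_num)).comp tendsto_natCast_atTop_atTop).eventually_ge_atTop _
  obtain ⟨R, hR1, hR⟩ := (ht.and (Filter.eventually_ge_atTop 3)).exists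
  refine ⟨R, hR, ?_⟩
  have hR' : (3 : ℝ) ≤ R := by exact_mod_cast hR
  have hR0 : (0 : ℝ) < R := by linarith
  have h1 := h R (by omega)
  have h2 : ((cell R).card : ℝ) ≤ (block R).card := by exact_mod_cast card_cell_le_card_block R
  set r := (R : ℝ) ^ (1 / 40 : ℝ) with hr
  have hr1 : 1 ≤ r := Real.one_le_rpow (by linarith) (by norm_num)
  have h3 : Real.log (3 * (R : ℝ) ^ 2 + 2) ≤ 200 * r := by
    calc Real.log (3 * (R : ℝ) ^ 2 + 2) ≤ Real.log ((R : ℝ) ^ 5) := by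
          apply Real.log_le_log (by positivity)
          nlinarith [pow_le_pow_left₀ (by norm_num) hR' 3, sq_nonneg (R : ℝ)]
      _ = 5 * Real.log R := by rw [Real.log_pow]; norm_num
      _ ≤ 5 * (r / (1 / 40)) := by
          gcongr
          exact Real.log_le_rpow_div hR0.le (by norm_num)
      _ = 200 * r := by ring
  have h4 : (R : ℝ) ^ (1 / 10 : ℝ) = r * r * (R : ℝ) ^ (1 / 20 : ℝ) := by
    rw [hr, ← Real.rpow_add hR0, ← Real.rpow_add hR0]
    norm_num
  have h5 : (R : ℝ) ^ (1 / 10 : ℝ) ≤ (2 * R : ℝ) ^ (1 / 10 : ℝ) :=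
    Real.rpow_le_rpow hR0.le (by linarith) (by norm_num)
  calc 2 * (2 * cellBound R) * (2 * R : ℝ)
      = 192 * (R : ℝ) ^ 2 * (1 + Real.log (3 * (R : ℝ) ^ 2 + 2)) := by rw [cellBound]; ring
    _ ≤ 192 * (C * r * (block R).card) * (201 * r) := by
        have : (R : ℝ) ^ 2 ≤ C * r * (block R).card := h1.trans (by gcongr)
        have hl : 1 + Real.log (3 * (R : ℝ) ^ 2 + 2) ≤ 201 * r := by linarith
        have hlog : 0 ≤ 1 + Real.log (3 * (R : ℝ) ^ 2 + 2) := by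
          have := Real.log_nonneg (x := 3 * (R : ℝ) ^ 2 + 2) (by nlinarith)
          linarith
        gcongr
    _ = (block R).card * (r * r * (192 * C * 201)) := by ring
    _ ≤ (block R).card * (r * r * (R : ℝ) ^ (1 / 20 : ℝ)) := by gcongr
    _ ≤ _ := by rw [← h4]; gcongr

theorem exists_pow_ge_and_le {Y n : ℕ} (hY : 2 ≤ Y) (hn : 1 ≤ n) :
    ∃ k : ℕ, n ≤ Y ^ (2 * k) ∧ Y ^ (2 * k) ≤ Y ^ 2 * n := by
  have hex : ∃ k, n ≤ Y ^ (2 * k) := by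
    refine ⟨n, (Nat.lt_pow_self (by omega : 1 < Y)).le.trans ?_⟩
    exact Nat.pow_le_pow_right (by omega) (by omega)
  classical
  refine ⟨Nat.find hex, Nat.find_spec hex, ?_⟩
  rcases Nat.eq_zero_or_pos (Nat.find hex) with h0 | h0
  · rw [h0]
    have : 0 < Y ^ 2 := by positivity
    rw [mul_zero, pow_zero]
    exact Nat.mul_pos this hn
  · have := Nat.find_min hex (Nat.sub_lt h0 one_pos)
    rw [not_le] at this
    calc Y ^ (2 * Nat.find hex) = Y ^ 2 * Y ^ (2 * (Nat.find hex - 1)) := by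
          rw [← pow_add]; congr 1; omega
      _ ≤ _ := by gcongr

theorem card_block_pos {R : ℕ} (hR : 3 ≤ R) : 0 < (block R).card := by
  rw [Finset.card_pos]
  by_contra h
  rw [Finset.not_nonempty_iff_eq_empty] at h
  have := closure_block_eq_top hR
  rw [h, Finset.coe_empty, Subgroup.closure_empty] at this
  have h1 : (upperSL 1 : SpecialLinearGroup (Fin 2) ℤ) ∈ (⊥ : Subgroup _) := this ▸ trivial
  have h2 := congrArg (fun g : SpecialLinearGroup (Fin 2) ℤ => g 0 1) (Subgroup.mem_bot.1 h1)
  simp at h2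

/-- Large multiplicity forces an eigenvalue to be small. -/
theorem exists_eigenvalue_le_half {R : ℕ} (hR : 3 ≤ R)
    (hR' : 2 * (2 * cellBound R) * (2 * R : ℝ) ≤ (block R).card * (2 * R : ℝ) ^ (1 / 10 : ℝ)) :
    ∃ N₀ : ℕ, ∀ N : ℕ, ∀ _ : NeZero N, N₀ ≤ N → ∀ μ : ℝ,
      (Finset.univ.image fun t : (ZMod N)ˣ => t ^ 2).card ≤
        Module.finrank ℂ ((blockOp R N).eigenspace (μ : ℂ)) → μ ≤ (block R).card / 2 := by
  obtain ⟨C₁, hC₁, h₁⟩ := ZMod.exists_card_squares_ge (ε := 1 / 10) (by norm_num)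
  obtain ⟨C₂, hC₂, h₂⟩ := exists_sum_gammaBall_le (ε := 1 / 10) (by norm_num)
  set Y : ℝ := 2 * R with hY
  have hRr : (3 : ℝ) ≤ R := by exact_mod_cast hR
  have hY1 : 1 ≤ Y := by linarith
  have ht : ∀ᶠ N : ℕ in Filter.atTop,
      C₁ * C₂ * (Y ^ 2) ^ (2 / 10 : ℝ) < (N : ℝ) ^ (3 / 10 : ℝ) :=
    ((tendsto_rpow_atTop (by norm_num)).comp tendsto_natCast_atTop_atTop).eventually_gt_atTop _
  obtain ⟨N₀, hN₀⟩ := Filter.eventually_atTop.1 (ht.and (Filter.eventually_ge_atTop 3))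
  refine ⟨N₀, fun N _ hN μ hfin => ?_⟩
  obtain ⟨hbig, hN3⟩ := hN₀ N hN
  by_contra! hμ
  have hNr : (3 : ℝ) ≤ N := by exact_mod_cast hN3
  have hNpos : (0 : ℝ) < N := by linarith
  obtain ⟨k, hk1, hk2⟩ := exists_pow_ge_and_le (Y := 2 * R) (n := N ^ 3) (by omega)
    (Nat.one_le_pow _ _ (by omega))
  set X : ℕ := (2 * R) ^ (2 * k) with hX
  have hXY : (X : ℝ) = Y ^ (2 * k) := by rw [hX]; push_cast; rfl
  have hX0 : (0 : ℝ) < X := by rw [hXY]; positivity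
  set Λ := 2 * cellBound R
  have hΛ : 0 ≤ Λ := by have := cellBound_nonneg R; positivity
  set b := ((block R).card : ℝ)
  have hb0 : 0 ≤ b := Nat.cast_nonneg _
  set F := (Module.finrank ℂ ((blockOp R N).eigenspace (μ : ℂ)) : ℝ)
  have hF : (N : ℝ) ≤ C₁ * (N : ℝ) ^ (1 / 10 : ℝ) * F :=
    (h₁ N ‹_›).trans (by gcongr; exact Nat.cast_le.2 hfin)
  have hF0 : 0 ≤ F := Nat.cast_nonneg _
  have e1 : F * μ ^ (2 * k) ≤ Λ ^ (2 * k) * (C₂ * (X : ℝ) ^ (1 / 10 : ℝ) * X) := by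
    refine (finrank_eigenspace_mul_le R k μ).trans ?_
    calc (N : ℝ) ^ 3 * ∑ g ∈ gammaBall N X, wordCount R (2 * k) g
        ≤ (N : ℝ) ^ 3 * ∑ g ∈ gammaBall N X, Λ ^ (2 * k) * (1 / slNorm g) := by
          gcongr with g _
          exact wordCount_le R (2 * k) g
      _ ≤ (N : ℝ) ^ 3 * (Λ ^ (2 * k) * (C₂ * (X : ℝ) ^ (1 / 10 : ℝ) * (X / (N : ℝ) ^ 3))) := by
          rw [← Finset.mul_sum]
          gcongr
          exact h₂ N X hN3 hk1
      _ = _ := by field_simp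
  have hbpos : 0 < b := Nat.cast_pos.2 (card_block_pos hR)
  clear_value Λ
  have e2 : (2 * Λ * Y) ^ (2 * k) ≤ b ^ (2 * k) * (X : ℝ) ^ (1 / 10 : ℝ) := by
    calc (2 * Λ * Y) ^ (2 * k) ≤ (b * Y ^ (1 / 10 : ℝ)) ^ (2 * k) := by gcongr
      _ = _ := by
        rw [mul_pow, hXY, ← Real.rpow_natCast (Y ^ (1 / 10 : ℝ)), ← Real.rpow_mul (by positivity),
          ← Real.rpow_natCast Y (2 * k), ← Real.rpow_mul (by positivity), mul_comm (1 / 10 : ℝ)]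
  have e3 : F ≤ C₂ * (X : ℝ) ^ (2 / 10 : ℝ) := by
    have : F * b ^ (2 * k) ≤ C₂ * (X : ℝ) ^ (2 / 10 : ℝ) * b ^ (2 * k) := by
      calc F * b ^ (2 * k) ≤ F * (2 * μ) ^ (2 * k) := by gcongr; linarith
        _ = 2 ^ (2 * k) * (F * μ ^ (2 * k)) := by rw [mul_pow]; ring
        _ ≤ 2 ^ (2 * k) * (Λ ^ (2 * k) * (C₂ * (X : ℝ) ^ (1 / 10 : ℝ) * X)) := by gcongr
        _ = C₂ * (X : ℝ) ^ (1 / 10 : ℝ) * (2 * Λ * Y) ^ (2 * k) := by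
          rw [mul_pow, mul_pow, hXY]; ring
        _ ≤ C₂ * (X : ℝ) ^ (1 / 10 : ℝ) * (b ^ (2 * k) * (X : ℝ) ^ (1 / 10 : ℝ)) := by gcongr
        _ = C₂ * ((X : ℝ) ^ (1 / 10 : ℝ) * (X : ℝ) ^ (1 / 10 : ℝ)) * b ^ (2 * k) := by ring
        _ = _ := by rw [← Real.rpow_add hX0]; norm_num
    exact le_of_mul_le_mul_right this (by positivity)
  have e4 : (X : ℝ) ^ (2 / 10 : ℝ) ≤ (Y ^ 2) ^ (2 / 10 : ℝ) * (N : ℝ) ^ (6 / 10 : ℝ) := by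
    have : (X : ℝ) ≤ Y ^ 2 * (N : ℝ) ^ 3 := by
      rw [hY]
      exact_mod_cast hk2
    calc (X : ℝ) ^ (2 / 10 : ℝ) ≤ (Y ^ 2 * (N : ℝ) ^ 3) ^ (2 / 10 : ℝ) :=
          Real.rpow_le_rpow hX0.le this (by norm_num)
      _ = _ := by
        rw [Real.mul_rpow (by positivity) (by positivity), ← Real.rpow_natCast (N : ℝ) 3,
          ← Real.rpow_mul hNpos.le]
        norm_num
  have e5 : (N : ℝ) ≤ C₁ * C₂ * (Y ^ 2) ^ (2 / 10 : ℝ) * (N : ℝ) ^ (7 / 10 : ℝ) := by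
    calc (N : ℝ) ≤ C₁ * (N : ℝ) ^ (1 / 10 : ℝ) * (C₂ * ((Y ^ 2) ^ (2 / 10 : ℝ) *
          (N : ℝ) ^ (6 / 10 : ℝ))) := hF.trans (by gcongr; exact e3.trans (by gcongr))
      _ = C₁ * C₂ * (Y ^ 2) ^ (2 / 10 : ℝ) *
          ((N : ℝ) ^ (1 / 10 : ℝ) * (N : ℝ) ^ (6 / 10 : ℝ)) := by ring
      _ = _ := by rw [← Real.rpow_add hNpos]; norm_num
  have e6 : (N : ℝ) = (N : ℝ) ^ (3 / 10 : ℝ) * (N : ℝ) ^ (7 / 10 : ℝ) := by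
    rw [← Real.rpow_add hNpos]; norm_num
  have e7 : 0 < (N : ℝ) ^ (7 / 10 : ℝ) := by positivity
  nlinarith [mul_lt_mul_of_pos_right hbig e7]

/-- The nontrivial eigenvalues of the block operators are bounded away from the trivial one,
uniformly in the level. -/
theorem exists_eigenvalue_gap :
    ∃ R : ℕ, 3 ≤ R ∧ ∃ κ : ℝ, 0 < κ ∧ ∀ N : ℕ, 0 < N → ∀ μ : ℝ,
      (blockOp R N).HasEigenvalue (μ : ℂ) → μ ≠ (block R).card →
        μ ≤ (1 - κ) * (block R).card := by
  obtain ⟨R, hR, hR'⟩ := exists_card_block_mul_rpow_ge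
  obtain ⟨N₀, hN₀⟩ := exists_eigenvalue_le_half hR hR'
  have hb : (0 : ℝ) < (block R).card := Nat.cast_pos.2 (card_block_pos hR)
  let s : Set ℝ := ⋃ N ∈ Finset.Ico 1 N₀, {μ : ℝ | (blockOp R N).HasEigenvalue (μ : ℂ)}
  have hs : s.Finite := by
    refine Set.Finite.biUnion (Finset.finite_toSet _) fun N hN => ?_
    have : NeZero N := ⟨by have := Finset.mem_Ico.1 hN; omega⟩
    exact (Module.End.finite_hasEigenvalue (blockOp R N)).preimage
      Complex.ofReal_injective.injOn
  obtain ⟨κ, h0, h1, h2⟩ := exists_gap_of_finite hs hb fun x hx => by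
    simp only [s, Set.mem_iUnion] at hx
    obtain ⟨N, hN, hx⟩ := hx
    have : NeZero N := ⟨by have := Finset.mem_Ico.1 hN; omega⟩
    exact le_card_block_of_hasEigenvalue hx
  refine ⟨R, hR, κ, h0, fun N => ?_⟩
  induction N using Nat.strong_induction_on with
  | _ N ih =>
  intro hN μ hμ hne
  have : NeZero N := ⟨hN.ne'⟩
  rcases lt_or_ge N N₀ with hlt | hge
  · exact h2 μ (Set.mem_biUnion (Finset.mem_coe.2 (Finset.mem_Ico.2 ⟨hN, hlt⟩)) hμ) hne
  · rcases le_finrank_or_hasEigenvalue hμ with h | ⟨M, hM, hMN, h⟩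
    · refine (hN₀ N ‹_› hge μ h).trans ?_
      nlinarith
    · exact ih M hMN hM μ h hne

section Gap

variable {R N : ℕ} [NeZero N]

/-- A function with zero energy along a generating block is constant. -/
theorem apply_eq_apply_of_sum_norm_sub_sq_eq_zero (hR : 3 ≤ R)
    {f : EuclideanSpace ℂ (SpecialLinearGroup (Fin 2) (ZMod N))}
    (hf : ∑ x, ∑ h ∈ block R, ‖f (x * redSL N h) - f x‖ ^ 2 = 0)
    (x : SpecialLinearGroup (Fin 2) (ZMod N)) : f x = f 1 := by
  let H : Subgroup (SpecialLinearGroup (Fin 2) ℤ) :=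
    { carrier := {h | ∀ x, f (x * redSL N h) = f x}
      one_mem' := fun x => by simp
      mul_mem' := fun {a b} ha hb x => by
        rw [map_mul, ← mul_assoc, hb, ha]
      inv_mem' := fun {a} ha x => by
        rw [← ha (x * redSL N a⁻¹), map_inv, inv_mul_cancel_right] }
  have hH : H = ⊤ := by
    rw [eq_top_iff, ← closure_block_eq_top hR, Subgroup.closure_le]
    intro h hh y
    rw [Finset.sum_eq_zero_iff_of_nonneg fun _ _ => by positivity] at hf
    have h1 := hf y (Finset.mem_univ _)
    rw [Finset.sum_eq_zero_iff_of_nonneg fun _ _ => by positivity] at h1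
    simpa [sub_eq_zero] using h1 h hh
  obtain ⟨g, rfl⟩ := redSL_surjective N x
  have : g ∈ H := hH ▸ trivial
  simpa using this 1

/-- The functions on `SL₂(ℤ/Nℤ)` of mean zero. -/
noncomputable def meanZero (N : ℕ) [NeZero N] :
    Submodule ℂ (EuclideanSpace ℂ (SpecialLinearGroup (Fin 2) (ZMod N))) where
  carrier := {f | ∑ x, f x = 0}
  zero_mem' := by simp
  add_mem' {f g} hf hg := by
    simp only [Set.mem_ofPred_eq] at hf hg ⊢
    simp [Finset.sum_add_distrib, hf, hg]
  smul_mem' c f hf := by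
    simp only [Set.mem_ofPred_eq] at hf ⊢
    simp [← Finset.mul_sum, hf]

theorem mem_meanZero {f : EuclideanSpace ℂ (SpecialLinearGroup (Fin 2) (ZMod N))} :
    f ∈ meanZero N ↔ ∑ x, f x = 0 := Iff.rfl

theorem blockOp_mem_meanZero {f : EuclideanSpace ℂ (SpecialLinearGroup (Fin 2) (ZMod N))}
    (hf : f ∈ meanZero N) : blockOp R N f ∈ meanZero N := by
  rw [mem_meanZero] at hf ⊢
  simp only [blockOp_apply]
  rw [Finset.sum_comm]
  refine Finset.sum_eq_zero fun h _ => ?_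
  rw [← hf]
  exact Fintype.sum_equiv (Equiv.mulRight (redSL N h)) _ _ fun x => rfl

theorem ne_card_block_of_mem_meanZero (hR : 3 ≤ R) {μ : ℝ}
    {f : EuclideanSpace ℂ (SpecialLinearGroup (Fin 2) (ZMod N))} (hf : f ∈ meanZero N)
    (hf0 : f ≠ 0) (hμ : blockOp R N f = (μ : ℂ) • f) : μ ≠ (block R).card := by
  rintro rfl
  apply hf0
  have h1 := sum_norm_sub_sq_eq_of_apply_eq_smul hμ
  rw [sub_self, zero_mul, mul_zero] at h1
  have h2 := apply_eq_apply_of_sum_norm_sub_sq_eq_zero hR h1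
  rw [mem_meanZero] at hf
  simp only [h2] at hf
  rw [Finset.sum_const, nsmul_eq_mul, mul_eq_zero] at hf
  have h3 : f 1 = 0 := hf.resolve_left (by simp)
  ext x
  rw [h2, h3]
  rfl

end Gap

/-- The spectral gap of the block operators. -/
theorem exists_spectral_gap :
    ∃ R : ℕ, ∃ κ : ℝ, 0 < κ ∧ ∀ N : ℕ, ∀ _ : NeZero N,
      ∀ f : EuclideanSpace ℂ (SpecialLinearGroup (Fin 2) (ZMod N)), ∑ x, f x = 0 →
        κ * ‖f‖ ^ 2 ≤
          ∑ x, ∑ h ∈ block R, ‖f (x * redSL N h) - f x‖ ^ 2 := by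
  obtain ⟨R, hR, κ, hκ, hgap⟩ := exists_eigenvalue_gap
  refine ⟨R, 2 * κ * (block R).card, ?_, fun N _ f hf => ?_⟩
  · have := card_block_pos hR
    positivity
  have hinv : ∀ f ∈ meanZero N, blockOp R N f ∈ meanZero N := fun f => blockOp_mem_meanZero
  have hsym := (blockOp_isSymmetric (N := N) R).restrict_invariant hinv
  set T := (blockOp R N).restrict hinv with hT
  let b := hsym.eigenvectorBasis rfl
  have hval : ∀ i, hsym.eigenvalues rfl i ≤ (1 - κ) * (block R).card := by
    intro i
    have h1 := hsym.apply_eigenvectorBasis rfl i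
    have h2 : blockOp R N (b i).1 = ((hsym.eigenvalues rfl i : ℝ) : ℂ) • (b i).1 :=
      congrArg Subtype.val h1
    have h3 : (b i).1 ≠ 0 := by
      intro h
      have := b.orthonormal.ne_zero i
      exact this (Subtype.ext h)
    exact hgap N (NeZero.pos N) _ (Module.End.hasEigenvalue_of_hasEigenvector
      ⟨Module.End.mem_eigenspace_iff.2 h2, h3⟩) (ne_card_block_of_mem_meanZero hR (b i).2 h3 h2)
  let F : meanZero N := ⟨f, hf⟩
  have hin : (inner ℂ (blockOp R N f) f).re ≤ (1 - κ) * (block R).card * ‖f‖ ^ 2 := by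
    have h1 : inner ℂ (blockOp R N f) f = inner ℂ (T F) F := rfl
    have h2 : ‖f‖ ^ 2 = ∑ i, ‖b.repr F i‖ ^ 2 := by
      rw [← EuclideanSpace.norm_sq_eq, b.repr.norm_map]
      rfl
    rw [h1, h2, ← b.repr.inner_map_map, PiLp.inner_apply, Complex.re_sum, Finset.mul_sum]
    refine Finset.sum_le_sum fun i _ => ?_
    have h3 : b.repr (T F) i = ((hsym.eigenvalues rfl i : ℝ) : ℂ) * b.repr F i :=
      hsym.eigenvectorBasis_apply_self_apply rfl F i
    rw [h3, ← smul_eq_mul, inner_smul_left, inner_self_eq_norm_sq_to_K]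
    have h4 : ((starRingEnd ℂ) ((hsym.eigenvalues rfl i : ℝ) : ℂ) *
        ((‖b.repr F i‖ : ℝ) : ℂ) ^ 2).re = hsym.eigenvalues rfl i * ‖b.repr F i‖ ^ 2 := by
      simp [← Complex.ofReal_pow]
    refine h4.le.trans ?_
    gcongr
    exact hval i
  rw [sum_norm_sub_sq_eq]
  nlinarith

/-! ### From the spectral gap to vertex expansion -/

/-- The external neighbourhood of a set in the Cayley graph of `genS N ∪ (genS N)⁻¹`. -/
def outerBoundary (N : ℕ) (U : Set (SpecialLinearGroup (Fin 2) (ZMod N))) :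
    Set (SpecialLinearGroup (Fin 2) (ZMod N)) :=
  {g | g ∉ U ∧ ∃ u ∈ U, ∃ s ∈ genS N ∪ (genS N)⁻¹, g = u * s}

/-- The points of `U` that leave `U` under right multiplication by `g`. -/
def exitSet (N : ℕ) (g : SpecialLinearGroup (Fin 2) ℤ)
    (U : Set (SpecialLinearGroup (Fin 2) (ZMod N))) : Set (SpecialLinearGroup (Fin 2) (ZMod N)) :=
  {x | x ∈ U ∧ x * redSL N g ∉ U}

/-- Leaving sets along `g` costs a bounded multiple of the boundary, uniformly in the level. -/
def ExitBounded (g : SpecialLinearGroup (Fin 2) ℤ) : Prop :=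
  ∃ l : ℕ, ∀ N : ℕ, ∀ _ : NeZero N, ∀ U : Set (SpecialLinearGroup (Fin 2) (ZMod N)),
    (exitSet N g U).ncard ≤ l * (outerBoundary N U).ncard

theorem exitBounded_one : ExitBounded 1 := by
  refine ⟨0, fun N _ U => ?_⟩
  have : exitSet N 1 U = ∅ := by
    ext x
    simp [exitSet]
  simp [this]

theorem ExitBounded.mul {a b : SpecialLinearGroup (Fin 2) ℤ} (ha : ExitBounded a)
    (hb : ExitBounded b) : ExitBounded (a * b) := by
  obtain ⟨l, hl⟩ := ha
  obtain ⟨m, hm⟩ := hb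
  refine ⟨l + m, fun N _ U => ?_⟩
  have hsub : exitSet N (a * b) U ⊆ exitSet N a U ∪ (· * redSL N a) ⁻¹' exitSet N b U := by
    rintro x ⟨hx, hx'⟩
    rw [map_mul, ← mul_assoc] at hx'
    by_cases h : x * redSL N a ∈ U
    · exact Or.inr ⟨h, hx'⟩
    · exact Or.inl ⟨hx, h⟩
  calc (exitSet N (a * b) U).ncard
      ≤ (exitSet N a U).ncard + ((· * redSL N a) ⁻¹' exitSet N b U).ncard :=
        (Set.ncard_le_ncard hsub (Set.toFinite _)).trans (Set.ncard_union_le _ _)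
    _ = (exitSet N a U).ncard + (exitSet N b U).ncard := by
        congr 1
        refine Set.ncard_congr (fun x _ => x * redSL N a) (fun x hx => hx)
          (fun x y _ _ h => mul_right_cancel h) fun y hy => ⟨y * (redSL N a)⁻¹, ?_, ?_⟩
        · simpa using hy
        · simp
    _ ≤ (l + m) * (outerBoundary N U).ncard := by
        rw [add_mul]
        exact add_le_add (hl N ‹_› U) (hm N ‹_› U)

theorem exitBounded_of_mem {g : SpecialLinearGroup (Fin 2) ℤ}
    (hg : ∀ N, redSL N g ∈ genS N ∪ (genS N)⁻¹) : ExitBounded g := by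
  refine ⟨1, fun N _ U => ?_⟩
  rw [one_mul]
  exact Set.ncard_le_ncard_of_injOn (· * redSL N g)
    (fun x hx => ⟨hx.2, x, hx.1, _, hg N, rfl⟩) (fun x _ y _ h => mul_right_cancel h)
    (Set.toFinite _)

theorem redSL_upperSL_one (N : ℕ) : redSL N (upperSL 1) = slA N := by
  rw [redSL_upperSL]
  apply sl2_ext <;> simp [slA]

theorem redSL_lowerSL_one (N : ℕ) : redSL N (lowerSL 1) = slD N := by
  rw [redSL_lowerSL]
  apply sl2_ext <;> simp [slD]

theorem exitBounded (g : SpecialLinearGroup (Fin 2) ℤ) : ExitBounded g := by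
  let H : Subgroup (SpecialLinearGroup (Fin 2) ℤ) :=
    { carrier := {g | ExitBounded g ∧ ExitBounded g⁻¹}
      one_mem' := ⟨exitBounded_one, by rw [inv_one]; exact exitBounded_one⟩
      mul_mem' := fun ha hb => ⟨ha.1.mul hb.1, by
        rw [_root_.mul_inv_rev]; exact hb.2.mul ha.2⟩
      inv_mem' := fun ha => ⟨ha.2, by rw [inv_inv]; exact ha.1⟩ }
  have hgen : ∀ g, (∀ N, redSL N g ∈ genS N) → g ∈ H := fun g hg =>
    ⟨exitBounded_of_mem fun N => Or.inl (hg N),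
      exitBounded_of_mem fun N => Or.inr (by rw [map_inv]; exact Set.inv_mem_inv.2 (hg N))⟩
  have h1 : upperSL 1 * lowerSL 1 ∈ H := hgen _ fun N => by
    rw [map_mul, redSL_upperSL_one, redSL_lowerSL_one]
    exact Or.inl rfl
  have h2 : upperSL 1 ^ 2 * lowerSL 1 ∈ H := hgen _ fun N => by
    rw [map_mul, map_pow, redSL_upperSL_one, redSL_lowerSL_one]
    exact Or.inr rfl
  have h3 : upperSL 1 ∈ H := by
    have := H.mul_mem h2 (H.inv_mem h1)
    rwa [_root_.mul_inv_rev, mul_assoc, mul_inv_cancel_left, pow_two, mul_inv_cancel_right] at this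
  have h4 : lowerSL 1 ∈ H := by
    have := H.mul_mem (H.inv_mem h3) h1
    rwa [inv_mul_cancel_left] at this
  have hH := eq_top_of_upperSL_mem_of_lowerSL_mem h3 h4
  have : g ∈ H := hH ▸ trivial
  exact this.1

section Indicator

variable {N : ℕ} [NeZero N]

open Classical in
/-- The indicator function of `U` minus its mean. -/
noncomputable def centeredIndicator (U : Set (SpecialLinearGroup (Fin 2) (ZMod N))) :
    EuclideanSpace ℂ (SpecialLinearGroup (Fin 2) (ZMod N)) :=
  WithLp.toLp 2 fun x => (((if x ∈ U then 1 else 0) -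
    U.ncard / Nat.card (SpecialLinearGroup (Fin 2) (ZMod N)) : ℝ) : ℂ)

open Classical in
theorem sum_ite_mem_eq_ncard (U : Set (SpecialLinearGroup (Fin 2) (ZMod N))) :
    ∑ x, (if x ∈ U then 1 else 0 : ℝ) = U.ncard := by
  rw [Finset.sum_boole, Set.ncard_eq_toFinset_card']
  congr 2
  ext x
  simp

theorem sum_centeredIndicator (U : Set (SpecialLinearGroup (Fin 2) (ZMod N))) :
    ∑ x, centeredIndicator U x = 0 := by
  classical
  have hG : (0 : ℝ) < Nat.card (SpecialLinearGroup (Fin 2) (ZMod N)) := by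
    exact_mod_cast Nat.card_pos
  simp only [centeredIndicator]
  rw [← Complex.ofReal_sum, Finset.sum_sub_distrib, sum_ite_mem_eq_ncard, Finset.sum_const,
    Finset.card_univ, ← Nat.card_eq_fintype_card, nsmul_eq_mul, mul_div_cancel₀ _ hG.ne', sub_self,
    Complex.ofReal_zero]

theorem norm_centeredIndicator_sq (U : Set (SpecialLinearGroup (Fin 2) (ZMod N))) :
    ‖centeredIndicator U‖ ^ 2 =
      U.ncard * (1 - U.ncard / Nat.card (SpecialLinearGroup (Fin 2) (ZMod N))) := by
  classical
  have hG : (0 : ℝ) < Nat.card (SpecialLinearGroup (Fin 2) (ZMod N)) := by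
    exact_mod_cast Nat.card_pos
  rw [EuclideanSpace.norm_sq_eq]
  set u : ℝ := U.ncard / Nat.card (SpecialLinearGroup (Fin 2) (ZMod N)) with hu
  have h1 : ∀ x, ‖centeredIndicator U x‖ ^ 2 =
      (1 - 2 * u) * (if x ∈ U then 1 else 0) + u ^ 2 := by
    intro x
    simp only [centeredIndicator, Complex.norm_real, Real.norm_eq_abs, sq_abs, ← hu]
    split_ifs <;> ring
  simp only [h1]
  rw [Finset.sum_add_distrib, ← Finset.mul_sum, sum_ite_mem_eq_ncard, Finset.sum_const,
    Finset.card_univ, ← Nat.card_eq_fintype_card, nsmul_eq_mul]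
  have : (Nat.card (SpecialLinearGroup (Fin 2) (ZMod N)) : ℝ) * u = U.ncard := by
    rw [hu, mul_div_cancel₀ _ hG.ne']
  linear_combination u * this

theorem sum_norm_centeredIndicator_sub_sq (U : Set (SpecialLinearGroup (Fin 2) (ZMod N)))
    (h : SpecialLinearGroup (Fin 2) ℤ) :
    ∑ x, ‖centeredIndicator U (x * redSL N h) - centeredIndicator U x‖ ^ 2 =
      (exitSet N h U).ncard + (exitSet N h⁻¹ U).ncard := by
  classical
  have h1 : ∀ x, ‖centeredIndicator U (x * redSL N h) - centeredIndicator U x‖ ^ 2 =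
      (if x ∈ exitSet N h U then 1 else 0) +
        if x * redSL N h ∈ exitSet N h⁻¹ U then 1 else 0 := by
    intro x
    simp only [centeredIndicator, ← Complex.ofReal_sub, sub_sub_sub_cancel_right,
      Complex.norm_real, Real.norm_eq_abs, sq_abs, exitSet, Set.mem_ofPred_eq, map_inv,
      mul_inv_cancel_right]
    by_cases ha : x ∈ U <;> by_cases hb : x * redSL N h ∈ U <;> simp [ha, hb]
  simp only [h1]
  rw [Finset.sum_add_distrib, sum_ite_mem_eq_ncard, ← sum_ite_mem_eq_ncard (exitSet N h⁻¹ U)]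
  congr 1
  exact Fintype.sum_equiv (Equiv.mulRight (redSL N h)) _ _ fun x => rfl

end Indicator

/-- The Cayley graph of `SL₂(ℤ/Nℤ)` with generating set `S ∪ S⁻¹`, `S = {AD, A²D}`,
is a `c`-expander for some absolute constant `c > 0` and all large enough `N`. -/
theorem sl2_cayley_expander :
    ∃ c : ℝ, 0 < c ∧ ∃ N₀ : ℕ, ∀ N : ℕ, N₀ ≤ N →
      ∀ U : Set (Matrix.SpecialLinearGroup (Fin 2) (ZMod N)),
        (U.ncard : ℝ) ≤ (Nat.card (Matrix.SpecialLinearGroup (Fin 2) (ZMod N)) : ℝ) / 2 →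
        c * U.ncard ≤
          (Set.ncard {g : Matrix.SpecialLinearGroup (Fin 2) (ZMod N) |
            g ∉ U ∧ ∃ u ∈ U, ∃ s ∈ genS N ∪ (genS N)⁻¹, g = u * s} : ℝ) := by
  obtain ⟨R, κ, hκ, hgap⟩ := exists_spectral_gap
  choose l hl using exitBounded
  set L := ∑ h ∈ block R, (l h + l h⁻¹) with hL
  refine ⟨κ / (2 * (L + 1)), by positivity, 1, fun N hN U hU => ?_⟩
  have : NeZero N := ⟨by omega⟩
  change _ ≤ ((outerBoundary N U).ncard : ℝ)
  have hG : (0 : ℝ) < Nat.card (SpecialLinearGroup (Fin 2) (ZMod N)) := by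
    exact_mod_cast Nat.card_pos
  have h1 := hgap N this (centeredIndicator U) (sum_centeredIndicator U)
  rw [norm_centeredIndicator_sq, Finset.sum_comm] at h1
  simp only [sum_norm_centeredIndicator_sub_sq] at h1
  have h2 : ∑ h ∈ block R, (((exitSet N h U).ncard : ℝ) + (exitSet N h⁻¹ U).ncard) ≤
      L * (outerBoundary N U).ncard := by
    rw [hL, Nat.cast_sum, Finset.sum_mul]
    refine Finset.sum_le_sum fun h _ => ?_
    rw [Nat.cast_add, add_mul]
    exact_mod_cast add_le_add (hl h N this U) (hl h⁻¹ N this U)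
  have h3 : (1 : ℝ) / 2 ≤ 1 - U.ncard / Nat.card (SpecialLinearGroup (Fin 2) (ZMod N)) := by
    have : (U.ncard : ℝ) / Nat.card (SpecialLinearGroup (Fin 2) (ZMod N)) ≤ 1 / 2 := by
      rw [div_le_iff₀ hG]
      linarith
    linarith
  have h4 : κ * (U.ncard * (1 / 2)) ≤ (L + 1) * (outerBoundary N U).ncard := by
    calc κ * (U.ncard * (1 / 2)) ≤ L * (outerBoundary N U).ncard :=
          (by gcongr : _ ≤ _).trans (h1.trans h2)
      _ ≤ _ := by gcongr; linarith
  rw [div_mul_eq_mul_div, div_le_iff₀ (by positivity)]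
  linarith
end

section
/- Let G be a finite group, let e be its identity element, and let S be a nonempty subset of G not containing e. Suppose that for some c > 0, for every subset U of G with |U| ≤ |G|/2, the set {g ∈ G : g ∉ U and g = u·s for some u ∈ U, s ∈ S ∪ S⁻¹} has size at least c·|U|. Then for every subset U of G with |U| ≤ |G|/2, the set {g ∈ G : g ∉ U and g = u·s for some u ∈ U, s ∈ S} has size at least (c/(2|S|))·|U|. -/
/-- For a fixed `s`, as many edges labelled `s` enter a set `U` as leave it. -/
lemma ncard_notMem_mul_mem_eq {G : Type*} [Group G] [Finite G] (U : Set G) (s : G) :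
    {g : G | g ∉ U ∧ g * s ∈ U}.ncard = {g : G | g ∈ U ∧ g * s ∉ U}.ncard := by
  have hP : ((· * s) ⁻¹' U).ncard = U.ncard :=
    Set.ncard_preimage_of_injective_subset_range (mul_left_injective s)
      fun x _ ↦ ⟨x * s⁻¹, by simp⟩
  have h1 : {g : G | g ∉ U ∧ g * s ∈ U} = ((· * s) ⁻¹' U) \ U := by
    ext; simp [and_comm]
  have h2 : {g : G | g ∈ U ∧ g * s ∉ U} = U \ ((· * s) ⁻¹' U) := by
    ext; simp
  rw [h1, h2]
  rwa [← Set.ncard_eq_ncard_iff_ncard_sdiff_eq_ncard_sdiff]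

/-- The neighborhood of `U` along edges in `S ∪ S⁻¹` is at most `|S| + 1` times as large as the
out-neighborhood of `U` along edges in `S`. -/
lemma ncard_neighbors_le_mul_ncard_out_neighbors {G : Type*} [Group G] [Finite G] (S U : Set G) :
    {g : G | g ∉ U ∧ ∃ u ∈ U, ∃ s ∈ S ∪ S⁻¹, g = u * s}.ncard ≤
      (S.ncard + 1) * {g : G | g ∉ U ∧ ∃ u ∈ U, ∃ s ∈ S, g = u * s}.ncard := by
  set N := {g : G | g ∉ U ∧ ∃ u ∈ U, ∃ s ∈ S, g = u * s}
  have hB : ∀ s ∈ S, {g : G | g ∉ U ∧ g * s ∈ U}.ncard ≤ N.ncard := fun s hs ↦ by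
    rw [ncard_notMem_mul_mem_eq]
    exact Set.ncard_le_ncard_of_injOn (· * s) (fun g hg ↦ ⟨hg.2, g, hg.1, s, hs, rfl⟩)
      (mul_left_injective s).injOn
  have hS := S.toFinite
  have hsub : {g : G | g ∉ U ∧ ∃ u ∈ U, ∃ s ∈ S ∪ S⁻¹, g = u * s} ⊆
      N ∪ ⋃ s ∈ hS.toFinset, {g : G | g ∉ U ∧ g * s ∈ U} := by
    rintro g ⟨hg, u, hu, s, hs | hs, rfl⟩
    · exact Or.inl ⟨hg, u, hu, s, hs, rfl⟩
    · refine Or.inr (Set.mem_biUnion (x := s⁻¹) (by simpa using hs) ⟨hg, ?_⟩)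
      simpa using hu
  calc _ ≤ (N ∪ ⋃ s ∈ hS.toFinset, {g : G | g ∉ U ∧ g * s ∈ U}).ncard := Set.ncard_le_ncard hsub
    _ ≤ N.ncard + (⋃ s ∈ hS.toFinset, {g : G | g ∉ U ∧ g * s ∈ U}).ncard := Set.ncard_union_le _ _
    _ ≤ N.ncard + ∑ s ∈ hS.toFinset, {g : G | g ∉ U ∧ g * s ∈ U}.ncard := by
      gcongr
      exact Finset.set_ncard_biUnion_le _ _
    _ ≤ N.ncard + hS.toFinset.card • N.ncard := by
      gcongr
      exact Finset.sum_le_card_nsmul _ _ _ fun s hs ↦ hB s (by simpa using hs)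
    _ = (S.ncard + 1) * N.ncard := by
      rw [← Set.ncard_eq_toFinset_card S hS, smul_eq_mul]
      ring

/-- If the Cayley graph `Cay(G, S ∪ S⁻¹)` of a finite group `G` is a `c`-expander, then the
Cayley digraph `Cay(G, S)` is a `(c/(2|S|))`-out-expander. -/
theorem expander_to_out_expander {G : Type*} [Group G] [Fintype G]
    (S : Set G) (hSne : S.Nonempty) (hSe : (1 : G) ∉ S) (c : ℝ) (hc : 0 < c)
    (hexp : ∀ U : Set G, (U.ncard : ℝ) ≤ (Fintype.card G : ℝ) / 2 →
      c * U.ncard ≤ (Set.ncard {g : G | g ∉ U ∧ ∃ u ∈ U, ∃ s ∈ S ∪ S⁻¹, g = u * s} : ℝ)) :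
    ∀ U : Set G, (U.ncard : ℝ) ≤ (Fintype.card G : ℝ) / 2 →
      c / (2 * S.ncard) * U.ncard ≤
        (Set.ncard {g : G | g ∉ U ∧ ∃ u ∈ U, ∃ s ∈ S, g = u * s} : ℝ) := by
  intro U hU
  have hS : (1 : ℝ) ≤ S.ncard := by
    exact_mod_cast (Set.ncard_pos S.toFinite).2 hSne
  have h : (Set.ncard {g : G | g ∉ U ∧ ∃ u ∈ U, ∃ s ∈ S ∪ S⁻¹, g = u * s} : ℝ) ≤
      (S.ncard + 1) * (Set.ncard {g : G | g ∉ U ∧ ∃ u ∈ U, ∃ s ∈ S, g = u * s} : ℝ) := by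
    exact_mod_cast ncard_neighbors_le_mul_ncard_out_neighbors S U
  rw [div_mul_eq_mul_div, div_le_iff₀ (by positivity), mul_comm (Set.ncard _ : ℝ)]
  refine ((hexp U hU).trans h).trans ?_
  gcongr
  linarith
end

section
/- Let a ≥ 1 be an integer and let x, y be integers with x > 0 and y ≥ 0. Let (u, v)ᵀ = B^a · C · (x, y)ᵀ, so that u = 2^{a-1}(4x + 2y) and v = 2^{a-1}((2a+2)x + (a+2)y). Then v > 0 and (2/(a+2))·v < u ≤ (2/(a+1))·v; equivalently, the ratio u/v lies in the half-open interval (2/(a+2), 2/(a+1)]. -/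
open Matrix

/-- The matrix `B = [[2,0],[1,2]]` over the integers. -/
def matB : Matrix (Fin 2) (Fin 2) ℤ := !![2, 0; 1, 2]

/-- The matrix `C = [[2,1],[1,1]]` over the integers. -/
def matC : Matrix (Fin 2) (Fin 2) ℤ := !![2, 1; 1, 1]

/-- Closed form of the positive powers of `matB`. -/
theorem matB_pow_succ (n : ℕ) :
    matB ^ (n + 1) = !![2 * 2 ^ n, 0; ((n : ℤ) + 1) * 2 ^ n, 2 * 2 ^ n] := by
  induction n with
  | zero => simp [matB]
  | succ n ih =>
    rw [pow_succ, ih, matB]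
    ext i j
    fin_cases i <;> fin_cases j <;> simp [Matrix.mul_apply, Fin.sum_univ_two] <;> ring

/-- If `a ≥ 1`, `x > 0`, `y ≥ 0` and `(u,v)ᵀ = Bᵃ C (x,y)ᵀ`, then `v > 0` and
`u/v ∈ (2/(a+2), 2/(a+1)]`, i.e. `2v < (a+2)u` and `(a+1)u ≤ 2v`. -/
theorem ratio_after_BC (a : ℕ) (ha : 1 ≤ a) (x y u v : ℤ) (hx : 0 < x) (hy : 0 ≤ y)
    (h : ![u, v] = (matB ^ a * matC) *ᵥ ![x, y]) :
    0 < v ∧ 2 * v < ((a : ℤ) + 2) * u ∧ ((a : ℤ) + 1) * u ≤ 2 * v := by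
  obtain ⟨n, rfl⟩ := Nat.exists_eq_add_of_le' ha
  rw [matB_pow_succ, matC] at h
  have hu : u = 2 ^ n * (4 * x + 2 * y) := by
    have h0 := congrFun h 0
    simp [Matrix.mulVec, dotProduct, Matrix.mul_apply, Fin.sum_univ_two] at h0
    rw [h0]; ring
  have hv : v = 2 ^ n * ((2 * n + 4) * x + (n + 3) * y) := by
    have h1 := congrFun h 1
    simp [Matrix.mulVec, dotProduct, Matrix.mul_apply, Fin.sum_univ_two] at h1
    rw [h1]; ring
  have hpx : (0 : ℤ) < 2 ^ n * x := by positivity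
  have hpy : (0 : ℤ) ≤ 2 ^ n * y := by positivity
  subst hu hv
  push_cast
  refine ⟨by positivity, ?_, ?_⟩
  · linarith
  · linarith
end
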